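/- arXiv:2102.04240 — 7 statements merged into one kernel-verified Lean document; each statement's English description precedes it below -/
import Mathlib

section
/- Let d, s ∈ ℕ and let ρ ∈ Her_d ⊗ Her_s ≅ Her_{ds} be positive semidefinite with tensor rank at most 2, i.e. ρ = σ_1 ⊗ τ_1 + σ_2 ⊗ τ_2 for some Hermitian matrices σ_1, σ_2 ∈ Her_d and τ_1, τ_2 ∈ Her_s (not necessarily positive semidefinite). Then ρ is separable; moreover ρ admits a separable decomposition with at most two terms, i.e. ρ = a_1 ⊗ b_1 + a_2 ⊗ b_2 with a_1, a_2 ∈ Her_d and b_1, b_2 ∈ Her_s all positive semidefinite. -/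
open Matrix
open scoped Kronecker ComplexOrder

namespace Matrix

variable {m n : Type*}

lemma IsHermitian.real_smul {M : Matrix m m ℂ} (hM : M.IsHermitian) (c : ℝ) :
    (c • M).IsHermitian :=
  hM.smul (IsSelfAdjoint.all c)

/-- `ρ` is a sum of two Kronecker products of positive semidefinite matrices. -/
def IsTwoTermSeparable (ρ : Matrix (m × n) (m × n) ℂ) : Prop :=
  ∃ (a₁ a₂ : Matrix m m ℂ) (b₁ b₂ : Matrix n n ℂ),
    a₁.PosSemidef ∧ a₂.PosSemidef ∧ b₁.PosSemidef ∧ b₂.PosSemidef ∧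
    ρ = a₁ ⊗ₖ b₁ + a₂ ⊗ₖ b₂

lemma PosSemidef.isTwoTermSeparable_kronecker {a : Matrix m m ℂ} {b : Matrix n n ℂ}
    (ha : a.PosSemidef) (hb : b.PosSemidef) : IsTwoTermSeparable (a ⊗ₖ b) :=
  ⟨a, 0, b, 0, ha, .zero, hb, .zero, by simp⟩

variable [Fintype m] [Fintype n]

/-- The real part of the quadratic form `v ↦ v* M v`. -/
noncomputable def reQuadForm (M : Matrix m m ℂ) (v : m → ℂ) : ℝ :=
  (star v ⬝ᵥ (M *ᵥ v)).re

@[simp]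
lemma reQuadForm_add (M N : Matrix m m ℂ) (v : m → ℂ) :
    (M + N).reQuadForm v = M.reQuadForm v + N.reQuadForm v := by
  simp [reQuadForm, add_mulVec]

@[simp]
lemma reQuadForm_sub (M N : Matrix m m ℂ) (v : m → ℂ) :
    (M - N).reQuadForm v = M.reQuadForm v - N.reQuadForm v := by
  simp [reQuadForm, sub_mulVec]

@[simp]
lemma reQuadForm_neg (M : Matrix m m ℂ) (v : m → ℂ) :
    (-M).reQuadForm v = -M.reQuadForm v := by
  simp [reQuadForm, neg_mulVec]

@[simp]
lemma reQuadForm_smul (c : ℝ) (M : Matrix m m ℂ) (v : m → ℂ) :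
    (c • M).reQuadForm v = c * M.reQuadForm v := by
  simp [reQuadForm, smul_mulVec]

lemma IsHermitian.coe_reQuadForm {M : Matrix m m ℂ} (hM : M.IsHermitian) (v : m → ℂ) :
    (M.reQuadForm v : ℂ) = star v ⬝ᵥ (M *ᵥ v) :=
  Complex.ext rfl (hM.im_star_dotProduct_mulVec_self v).symm

lemma PosSemidef.reQuadForm_nonneg {M : Matrix m m ℂ} (hM : M.PosSemidef) (v : m → ℂ) :
    0 ≤ M.reQuadForm v :=
  (Complex.nonneg_iff.1 (hM.dotProduct_mulVec_nonneg v)).1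

lemma IsHermitian.posSemidef_of_reQuadForm_nonneg {M : Matrix m m ℂ} (hM : M.IsHermitian)
    (h : ∀ v, 0 ≤ M.reQuadForm v) : M.PosSemidef :=
  .of_dotProduct_mulVec_nonneg hM fun v => by
    rw [← hM.coe_reQuadForm]
    exact_mod_cast h v

open scoped MatrixOrder in
lemma IsHermitian.eq_zero_of_reQuadForm {M : Matrix m m ℂ} (hM : M.IsHermitian)
    (h : ∀ v, M.reQuadForm v = 0) : M = 0 := by
  refine le_antisymm (neg_nonneg.1 ?_) ?_
  · exact nonneg_iff_posSemidef.2
      (hM.neg.posSemidef_of_reQuadForm_nonneg fun v => by simp [h v])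
  · exact nonneg_iff_posSemidef.2 (hM.posSemidef_of_reQuadForm_nonneg fun v => (h v).ge)

lemma IsHermitian.reQuadForm_kronecker {M : Matrix m m ℂ} {N : Matrix n n ℂ}
    (hM : M.IsHermitian) (hN : N.IsHermitian) (u : m → ℂ) (v : n → ℂ) :
    (M ⊗ₖ N).reQuadForm (fun p => u p.1 * v p.2) = M.reQuadForm u * N.reQuadForm v := by
  have key : star (fun p : m × n => u p.1 * v p.2) ⬝ᵥ
      ((M ⊗ₖ N) *ᵥ fun p => u p.1 * v p.2) =
      (star u ⬝ᵥ (M *ᵥ u)) * (star v ⬝ᵥ (N *ᵥ v)) := by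
    have hmul : ((M ⊗ₖ N) *ᵥ fun p => u p.1 * v p.2) =
        fun p => (M *ᵥ u) p.1 * (N *ᵥ v) p.2 := by
      ext p
      simp only [mulVec, dotProduct, Fintype.sum_prod_type, kroneckerMap_apply,
        Finset.sum_mul_sum]
      exact Finset.sum_congr rfl fun i _ => Finset.sum_congr rfl fun j _ => by ring
    rw [hmul]
    simp only [dotProduct, Fintype.sum_prod_type, Finset.sum_mul_sum, Pi.star_apply, star_mul']
    exact Finset.sum_congr rfl fun i _ => Finset.sum_congr rfl fun j _ => by ring
  rw [reQuadForm, key, ← hM.coe_reQuadForm, ← hN.coe_reQuadForm, ← Complex.ofReal_mul,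
    Complex.ofReal_re]

lemma isTwoTermSeparable_of_posSemidef_kronecker {σ : Matrix m m ℂ} {τ : Matrix n n ℂ}
    (hσ : σ.IsHermitian) (hτ : τ.IsHermitian) (h : (σ ⊗ₖ τ).PosSemidef) :
    IsTwoTermSeparable (σ ⊗ₖ τ) := by
  have hpos (u v) : 0 ≤ σ.reQuadForm u * τ.reQuadForm v := by
    rw [← hσ.reQuadForm_kronecker hτ]
    exact h.reQuadForm_nonneg _
  by_cases hs : ∀ u, 0 ≤ σ.reQuadForm u
  · by_cases ht : ∀ v, 0 ≤ τ.reQuadForm v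
    · exact (hσ.posSemidef_of_reQuadForm_nonneg hs).isTwoTermSeparable_kronecker
        (hτ.posSemidef_of_reQuadForm_nonneg ht)
    · obtain ⟨v, hv⟩ := not_forall.1 ht
      have : σ = 0 := hσ.eq_zero_of_reQuadForm fun u => by nlinarith [hpos u v, hs u]
      simpa [this] using (PosSemidef.zero (n := m) (R := ℂ)).isTwoTermSeparable_kronecker
        (PosSemidef.zero (n := n) (R := ℂ))
  · obtain ⟨u, hu⟩ := not_forall.1 hs
    have ht (v) : τ.reQuadForm v ≤ 0 := by nlinarith [hpos u v]
    by_cases ht' : ∃ v, τ.reQuadForm v < 0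
    · obtain ⟨v, hv⟩ := ht'
      have hσ' : (-σ).PosSemidef := hσ.neg.posSemidef_of_reQuadForm_nonneg fun u => by
        rw [reQuadForm_neg]
        nlinarith [hpos u v]
      have hτ' : (-τ).PosSemidef := hτ.neg.posSemidef_of_reQuadForm_nonneg fun v => by
        simpa using ht v
      have heq : σ ⊗ₖ τ = (-σ) ⊗ₖ (-τ) := by ext; simp
      exact heq ▸ hσ'.isTwoTermSeparable_kronecker hτ'
    · push Not at ht'
      have : τ = 0 := hτ.eq_zero_of_reQuadForm fun v => le_antisymm (ht v) (ht' v)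
      simpa [this] using (PosSemidef.zero (n := m) (R := ℂ)).isTwoTermSeparable_kronecker
        (PosSemidef.zero (n := n) (R := ℂ))

section Pencil

variable {σ₁ σ₂ : Matrix m m ℂ} {τ₁ τ₂ : Matrix n n ℂ}

lemma isTwoTermSeparable_of_right_dependent
    (hσ₁ : σ₁.IsHermitian) (hσ₂ : σ₂.IsHermitian) (hτ₁ : τ₁.IsHermitian) (hτ₂ : τ₂.IsHermitian)
    (h : (σ₁ ⊗ₖ τ₁ + σ₂ ⊗ₖ τ₂).PosSemidef) {x y : ℝ} (hxy : x ≠ 0 ∨ y ≠ 0)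
    (hdep : x • τ₁ = y • τ₂) : IsTwoTermSeparable (σ₁ ⊗ₖ τ₁ + σ₂ ⊗ₖ τ₂) := by
  rcases hxy with hx | hy
  · have e : τ₁ = (y / x) • τ₂ := by
      rw [div_eq_inv_mul, mul_smul, ← hdep, inv_smul_smul₀ hx]
    have heq : σ₁ ⊗ₖ τ₁ + σ₂ ⊗ₖ τ₂ = ((y / x) • σ₁ + σ₂) ⊗ₖ τ₂ := by
      rw [e, kronecker_smul, add_kronecker, smul_kronecker]
    rw [heq] at h ⊢
    exact isTwoTermSeparable_of_posSemidef_kronecker ((hσ₁.real_smul _).add hσ₂) hτ₂ h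
  · have e : τ₂ = (x / y) • τ₁ := by
      rw [div_eq_inv_mul, mul_smul, hdep, inv_smul_smul₀ hy]
    have heq : σ₁ ⊗ₖ τ₁ + σ₂ ⊗ₖ τ₂ = (σ₁ + (x / y) • σ₂) ⊗ₖ τ₁ := by
      rw [e, kronecker_smul, add_kronecker, smul_kronecker]
    rw [heq] at h ⊢
    exact isTwoTermSeparable_of_posSemidef_kronecker (hσ₁.add (hσ₂.real_smul _)) hτ₁ h

lemma isTwoTermSeparable_of_left_dependent
    (hσ₁ : σ₁.IsHermitian) (hσ₂ : σ₂.IsHermitian) (hτ₁ : τ₁.IsHermitian) (hτ₂ : τ₂.IsHermitian)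
    (h : (σ₁ ⊗ₖ τ₁ + σ₂ ⊗ₖ τ₂).PosSemidef) {x y : ℝ} (hxy : x ≠ 0 ∨ y ≠ 0)
    (hdep : x • σ₁ = y • σ₂) : IsTwoTermSeparable (σ₁ ⊗ₖ τ₁ + σ₂ ⊗ₖ τ₂) := by
  rcases hxy with hx | hy
  · have e : σ₁ = (y / x) • σ₂ := by
      rw [div_eq_inv_mul, mul_smul, ← hdep, inv_smul_smul₀ hx]
    have heq : σ₁ ⊗ₖ τ₁ + σ₂ ⊗ₖ τ₂ = σ₂ ⊗ₖ ((y / x) • τ₁ + τ₂) := by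
      rw [e, smul_kronecker, kronecker_add, kronecker_smul]
    rw [heq] at h ⊢
    exact isTwoTermSeparable_of_posSemidef_kronecker hσ₂ ((hτ₁.real_smul _).add hτ₂) h
  · have e : σ₂ = (x / y) • σ₁ := by
      rw [div_eq_inv_mul, mul_smul, hdep, inv_smul_smul₀ hy]
    have heq : σ₁ ⊗ₖ τ₁ + σ₂ ⊗ₖ τ₂ = σ₁ ⊗ₖ (τ₁ + (x / y) • τ₂) := by
      rw [e, smul_kronecker, kronecker_add, kronecker_smul]
    rw [heq] at h ⊢
    exact isTwoTermSeparable_of_posSemidef_kronecker hσ₁ (hτ₁.add (hτ₂.real_smul _)) h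

/-- If the joint numerical range of `(τ₁, τ₂)` contains both standard basis vectors, the cone of
positive semidefinite combinations of `τ₁` and `τ₂` lies in the first quadrant; its two extreme
rays and the dual basis give the separable decomposition. -/
lemma isTwoTermSeparable_of_reQuadForm_eq
    (hσ₁ : σ₁.IsHermitian) (hσ₂ : σ₂.IsHermitian) (hτ₁ : τ₁.IsHermitian) (hτ₂ : τ₂.IsHermitian)
    (h : (σ₁ ⊗ₖ τ₁ + σ₂ ⊗ₖ τ₂).PosSemidef) {v₁ v₂ : n → ℂ}
    (h₁₁ : τ₁.reQuadForm v₁ = 1) (h₁₂ : τ₁.reQuadForm v₂ = 0)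
    (h₂₁ : τ₂.reQuadForm v₁ = 0) (h₂₂ : τ₂.reQuadForm v₂ = 1) :
    IsTwoTermSeparable (σ₁ ⊗ₖ τ₁ + σ₂ ⊗ₖ τ₂) := by
  have hpos (u v) : 0 ≤ σ₁.reQuadForm u * τ₁.reQuadForm v +
      σ₂.reQuadForm u * τ₂.reQuadForm v := by
    rw [← hσ₁.reQuadForm_kronecker hτ₁, ← hσ₂.reQuadForm_kronecker hτ₂, ← reQuadForm_add]
    exact h.reQuadForm_nonneg _
  have hs₁ (u) : 0 ≤ σ₁.reQuadForm u := by simpa [h₁₁, h₂₁] using hpos u v₁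
  have hs₂ (u) : 0 ≤ σ₂.reQuadForm u := by simpa [h₁₂, h₂₂] using hpos u v₂
  let A : Set ℝ := ⋂ v, {x | 0 ≤ x * τ₁.reQuadForm v + (1 - x) * τ₂.reQuadForm v}
  have hmem {x} : x ∈ A ↔ ∀ v, 0 ≤ x * τ₁.reQuadForm v + (1 - x) * τ₂.reQuadForm v := by
    simp [A]
  have hclosed : IsClosed A := isClosed_iInter fun v =>
    isClosed_le continuous_const (by fun_prop)
  have hcompact : IsCompact A := isCompact_Icc.of_isClosed_subset hclosed
    fun x hx => (⟨by simpa [h₁₁, h₂₁] using hmem.1 hx v₁,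
      by simpa [h₁₂, h₂₂] using hmem.1 hx v₂⟩ : x ∈ Set.Icc (0 : ℝ) 1)
  have hratio (u) (hu : 0 < σ₁.reQuadForm u + σ₂.reQuadForm u) :
      σ₁.reQuadForm u / (σ₁.reQuadForm u + σ₂.reQuadForm u) ∈ A := hmem.2 fun v => by
    refine (div_nonneg (hpos u v) hu.le).trans_eq ?_
    rw [one_sub_div hu.ne']
    ring
  rcases A.eq_empty_or_nonempty with hA | hA
  · have hσ₁0 : σ₁ = 0 := hσ₁.eq_zero_of_reQuadForm fun u => by
      by_contra hne
      have : 0 < σ₁.reQuadForm u + σ₂.reQuadForm u :=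
        add_pos_of_pos_of_nonneg (lt_of_le_of_ne (hs₁ u) (Ne.symm hne)) (hs₂ u)
      simpa [hA] using hratio u this
    exact isTwoTermSeparable_of_left_dependent hσ₁ hσ₂ hτ₁ hτ₂ h (x := 1) (y := 0)
      (.inl one_ne_zero) (by simp [hσ₁0])
  obtain ⟨a, haA, ha⟩ := hcompact.exists_isLeast hA
  obtain ⟨b, hbA, hb⟩ := hcompact.exists_isGreatest hA
  have hlow (u) : 0 ≤ (1 - a) * σ₁.reQuadForm u - a * σ₂.reQuadForm u := by
    rcases (add_nonneg (hs₁ u) (hs₂ u)).eq_or_lt with h0 | h0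
    · have e₁ : σ₁.reQuadForm u = 0 := by linarith [hs₁ u, hs₂ u]
      have e₂ : σ₂.reQuadForm u = 0 := by linarith [hs₁ u, hs₂ u]
      simp [e₁, e₂]
    · have := (le_div_iff₀ h0).1 (ha (hratio u h0))
      linarith
  have hhigh (u) : 0 ≤ (b - 1) * σ₁.reQuadForm u + b * σ₂.reQuadForm u := by
    rcases (add_nonneg (hs₁ u) (hs₂ u)).eq_or_lt with h0 | h0
    · have e₁ : σ₁.reQuadForm u = 0 := by linarith [hs₁ u, hs₂ u]
      have e₂ : σ₂.reQuadForm u = 0 := by linarith [hs₁ u, hs₂ u]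
      simp [e₁, e₂]
    · have := (div_le_iff₀ h0).1 (hb (hratio u h0))
      linarith
  rcases (ha hbA).eq_or_lt with hab | hab
  · subst hab
    have hdep : (1 - a) • σ₁ = a • σ₂ := sub_eq_zero.1 <|
      ((hσ₁.real_smul _).sub (hσ₂.real_smul _)).eq_zero_of_reQuadForm fun u => by
        simp only [reQuadForm_sub, reQuadForm_smul]
        linarith [hlow u, hhigh u]
    refine isTwoTermSeparable_of_left_dependent hσ₁ hσ₂ hτ₁ hτ₂ h ?_ hdep
    by_contra! hcon
    linarith [hcon.1, hcon.2]
  · have hab' : 0 ≤ (b - a)⁻¹ := inv_nonneg.2 (sub_nonneg.2 hab.le)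
    have hne : ((b : ℂ) - a) ≠ 0 := by exact_mod_cast (sub_pos.2 hab).ne'
    refine ⟨(b - a)⁻¹ • ((b - 1) • σ₁ + b • σ₂), (b - a)⁻¹ • ((1 - a) • σ₁ - a • σ₂),
      a • τ₁ + (1 - a) • τ₂, b • τ₁ + (1 - b) • τ₂, ?_, ?_, ?_, ?_, ?_⟩
    · refine (((hσ₁.real_smul _).add (hσ₂.real_smul _)).real_smul _).posSemidef_of_reQuadForm_nonneg
        fun u => ?_
      simpa [mul_add] using mul_nonneg hab' (hhigh u)
    · refine (((hσ₁.real_smul _).sub (hσ₂.real_smul _)).real_smul _).posSemidef_of_reQuadForm_nonneg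
        fun u => ?_
      simpa [mul_sub] using mul_nonneg hab' (hlow u)
    · exact ((hτ₁.real_smul _).add (hτ₂.real_smul _)).posSemidef_of_reQuadForm_nonneg
        fun v => by simpa using hmem.1 haA v
    · exact ((hτ₁.real_smul _).add (hτ₂.real_smul _)).posSemidef_of_reQuadForm_nonneg
        fun v => by simpa using hmem.1 hbA v
    · ext p q
      simp only [add_apply, sub_apply, smul_apply, kroneckerMap_apply, Complex.real_smul]
      push_cast
      field_simp
      ring

end Pencil

lemma PosSemidef.isTwoTermSeparable_of_eq_add_kronecker
    {σ₁ σ₂ : Matrix m m ℂ} {τ₁ τ₂ : Matrix n n ℂ}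
    (hσ₁ : σ₁.IsHermitian) (hσ₂ : σ₂.IsHermitian) (hτ₁ : τ₁.IsHermitian) (hτ₂ : τ₂.IsHermitian)
    (h : (σ₁ ⊗ₖ τ₁ + σ₂ ⊗ₖ τ₂).PosSemidef) : IsTwoTermSeparable (σ₁ ⊗ₖ τ₁ + σ₂ ⊗ₖ τ₂) := by
  by_cases hdet : ∀ v w, τ₁.reQuadForm v * τ₂.reQuadForm w - τ₁.reQuadForm w * τ₂.reQuadForm v = 0
  · by_cases hzero : ∀ v, τ₁.reQuadForm v = 0
    · exact isTwoTermSeparable_of_right_dependent hσ₁ hσ₂ hτ₁ hτ₂ h (x := 1) (y := 0)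
        (.inl one_ne_zero) (by simp [hτ₁.eq_zero_of_reQuadForm hzero])
    · obtain ⟨w, hw⟩ := not_forall.1 hzero
      refine isTwoTermSeparable_of_right_dependent hσ₁ hσ₂ hτ₁ hτ₂ h
        (x := τ₂.reQuadForm w) (y := τ₁.reQuadForm w) (.inr hw) (sub_eq_zero.1 ?_)
      refine ((hτ₁.real_smul _).sub (hτ₂.real_smul _)).eq_zero_of_reQuadForm fun v => ?_
      simp only [reQuadForm_sub, reQuadForm_smul]
      linarith [hdet v w]
  · push Not at hdet
    obtain ⟨v, w, hD⟩ := hdet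
    set p := τ₁.reQuadForm v with hp
    set q := τ₁.reQuadForm w with hq
    set r := τ₂.reQuadForm v with hr
    set t := τ₂.reQuadForm w with ht
    have hD' : ((p : ℂ) * t - q * r) ≠ 0 := by exact_mod_cast hD
    have heq : σ₁ ⊗ₖ τ₁ + σ₂ ⊗ₖ τ₂ =
        (p • σ₁ + r • σ₂) ⊗ₖ ((p * t - q * r)⁻¹ • (t • τ₁ - q • τ₂)) +
        (q • σ₁ + t • σ₂) ⊗ₖ ((p * t - q * r)⁻¹ • (p • τ₂ - r • τ₁)) := by
      ext i j
      simp only [add_apply, sub_apply, smul_apply, kroneckerMap_apply, Complex.real_smul]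
      push_cast
      linear_combination (-(σ₁ i.1 j.1 * τ₁ i.2 j.2 + σ₂ i.1 j.1 * τ₂ i.2 j.2)) *
        mul_inv_cancel₀ hD'
    rw [heq] at h ⊢
    refine isTwoTermSeparable_of_reQuadForm_eq ((hσ₁.real_smul _).add (hσ₂.real_smul _))
      ((hσ₁.real_smul _).add (hσ₂.real_smul _))
      (((hτ₁.real_smul _).sub (hτ₂.real_smul _)).real_smul _)
      (((hτ₂.real_smul _).sub (hτ₁.real_smul _)).real_smul _) h (v₁ := v) (v₂ := w) ?_ ?_ ?_ ?_ <;>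
    · simp only [reQuadForm_sub, reQuadForm_smul, ← hp, ← hq, ← hr, ← ht]
      field_simp
      try ring

end Matrix

/-- A positive semidefinite matrix of tensor rank at most two,
`ρ = σ₁ ⊗ τ₁ + σ₂ ⊗ τ₂` with all `σᵢ, τᵢ` Hermitian, is separable; moreover it admits
a separable decomposition with at most two terms. -/
theorem posSemidef_tensor_rank_two_is_separable (d s : ℕ)
    (σ₁ σ₂ : Matrix (Fin d) (Fin d) ℂ) (τ₁ τ₂ : Matrix (Fin s) (Fin s) ℂ)
    (hσ₁ : σ₁.IsHermitian) (hσ₂ : σ₂.IsHermitian)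
    (hτ₁ : τ₁.IsHermitian) (hτ₂ : τ₂.IsHermitian)
    (ρ : Matrix (Fin d × Fin s) (Fin d × Fin s) ℂ)
    (hρ : ρ = σ₁ ⊗ₖ τ₁ + σ₂ ⊗ₖ τ₂) (hpsd : ρ.PosSemidef) :
    ∃ (a₁ a₂ : Matrix (Fin d) (Fin d) ℂ) (b₁ b₂ : Matrix (Fin s) (Fin s) ℂ),
      a₁.PosSemidef ∧ a₂.PosSemidef ∧ b₁.PosSemidef ∧ b₂.PosSemidef ∧
      ρ = a₁ ⊗ₖ b₁ + a₂ ⊗ₖ b₂ := by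
  subst hρ
  exact PosSemidef.isTwoTermSeparable_of_eq_add_kronecker hσ₁ hσ₂ hτ₁ hτ₂ hpsd
end

section
/- Let σ_1, σ_2 ∈ Her_m and suppose the spectrahedral cone C_1 = {(a,b) ∈ ℝ² : a σ_1 + b σ_2 is positive semidefinite} equals the conic hull of two linearly independent vectors v_1, v_2 ∈ ℝ². Then for every s ∈ ℕ and all Hermitian matrices τ_1, τ_2 ∈ Her_s, the Kronecker sum σ_1 ⊗ τ_1 + σ_2 ⊗ τ_2 is positive semidefinite if and only if there exist positive semidefinite η_1, η_2 ∈ Her_s with (τ_1, τ_2) = ((v_1)_1 η_1 + (v_2)_1 η_2, (v_1)_2 η_1 + (v_2)_2 η_2). -/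
open Matrix
open scoped Kronecker ComplexOrder

namespace Matrix

/-- The value of the quadratic form of a Hermitian matrix is real. -/
lemma IsHermitian.ofReal_re_dotProduct_mulVec {n : Type*} [Fintype n] {A : Matrix n n ℂ}
    (hA : A.IsHermitian) (y : n → ℂ) :
    (((star y ⬝ᵥ A *ᵥ y).re : ℝ) : ℂ) = star y ⬝ᵥ A *ᵥ y := by
  refine Complex.conj_eq_iff_re.mp ?_
  rw [← Complex.star_def, ← star_dotProduct, star_mulVec, hA.eq, ← dotProduct_mulVec]

/-- Compressing the second tensor factor of a positive semidefinite Kronecker sum by a vector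
yields a positive semidefinite combination of the first factors. -/
lemma PosSemidef.smul_add_smul_of_kronecker_add {m n : Type*} [Fintype m] [Fintype n]
    [DecidableEq m] {A B : Matrix m m ℂ} {S T : Matrix n n ℂ}
    (h : (A ⊗ₖ S + B ⊗ₖ T).PosSemidef) (y : n → ℂ) :
    ((star y ⬝ᵥ S *ᵥ y) • A + (star y ⬝ᵥ T *ᵥ y) • B).PosSemidef := by
  have hc := (h.conjTranspose_mul_mul_same
    ((1 : Matrix m m ℂ) ⊗ₖ replicateCol Unit y)).submatrix (fun i : m => (i, ()))
  have hq (C : Matrix n n ℂ) :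
      (replicateRow Unit (star y) * C * replicateCol Unit y) () () = star y ⬝ᵥ C *ᵥ y := by
    rw [Matrix.mul_assoc]
    rfl
  convert hc using 1
  rw [conjTranspose_kronecker, Matrix.mul_add, Matrix.add_mul, ← mul_kronecker_mul,
    ← mul_kronecker_mul, ← mul_kronecker_mul, ← mul_kronecker_mul]
  ext i j
  simp [hq, mul_comm]

end Matrix

/-- If the first level `C₁ = {(a,b) ∈ ℝ² | aσ₁ + bσ₂ ⪰ 0}` of the free spectrahedral
cone determined by Hermitian `σ₁, σ₂` is the conic hull of two linearly independent
vectors `v₁, v₂` (a simplex cone), then the whole free cone is determined by the first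
level: `σ₁ ⊗ τ₁ + σ₂ ⊗ τ₂ ⪰ 0` iff `(τ₁, τ₂)` is a `v₁, v₂`-combination of two psd
matrices. -/
theorem free_spectrahedral_cone_of_simplex_base (m : ℕ)
    (σ₁ σ₂ : Matrix (Fin m) (Fin m) ℂ) (hσ₁ : σ₁.IsHermitian) (hσ₂ : σ₂.IsHermitian)
    (v₁ v₂ : Fin 2 → ℝ) (hli : LinearIndependent ℝ ![v₁, v₂])
    (hbase : {p : Fin 2 → ℝ | (p 0 • σ₁ + p 1 • σ₂).PosSemidef} =
      {p | ∃ l₁ l₂ : ℝ, 0 ≤ l₁ ∧ 0 ≤ l₂ ∧ p = l₁ • v₁ + l₂ • v₂}) :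
    ∀ (s : ℕ) (τ₁ τ₂ : Matrix (Fin s) (Fin s) ℂ),
      τ₁.IsHermitian → τ₂.IsHermitian →
      ((σ₁ ⊗ₖ τ₁ + σ₂ ⊗ₖ τ₂).PosSemidef ↔
        ∃ η₁ η₂ : Matrix (Fin s) (Fin s) ℂ, η₁.PosSemidef ∧ η₂.PosSemidef ∧
          τ₁ = v₁ 0 • η₁ + v₂ 0 • η₂ ∧ τ₂ = v₁ 1 • η₁ + v₂ 1 • η₂) := by
  intro s τ₁ τ₂ hτ₁ hτ₂
  have hmem (p : Fin 2 → ℝ) : (p 0 • σ₁ + p 1 • σ₂).PosSemidef ↔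
      ∃ l₁ l₂ : ℝ, 0 ≤ l₁ ∧ 0 ≤ l₂ ∧ p = l₁ • v₁ + l₂ • v₂ := Set.ext_iff.mp hbase p
  constructor
  · intro h
    have hD : v₁ 0 * v₂ 1 - v₁ 1 * v₂ 0 ≠ 0 := by
      have hdet : IsUnit (Matrix.of ![v₁, v₂]) := linearIndependent_rows_iff_isUnit.mp hli
      rw [isUnit_iff_isUnit_det, det_fin_two, isUnit_iff_ne_zero] at hdet
      simpa [mul_comm] using hdet
    set D := v₁ 0 * v₂ 1 - v₁ 1 * v₂ 0 with hDdef
    have hform (y : Fin s → ℂ) : ∃ l₁ l₂ : ℝ, 0 ≤ l₁ ∧ 0 ≤ l₂ ∧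
        star y ⬝ᵥ τ₁ *ᵥ y = ((l₁ * v₁ 0 + l₂ * v₂ 0 : ℝ) : ℂ) ∧
        star y ⬝ᵥ τ₂ *ᵥ y = ((l₁ * v₁ 1 + l₂ * v₂ 1 : ℝ) : ℂ) := by
      have hc := h.smul_add_smul_of_kronecker_add y
      rw [← hτ₁.ofReal_re_dotProduct_mulVec, ← hτ₂.ofReal_re_dotProduct_mulVec] at hc
      obtain ⟨l₁, l₂, h₁, h₂, hp⟩ :=
        (hmem ![(star y ⬝ᵥ τ₁ *ᵥ y).re, (star y ⬝ᵥ τ₂ *ᵥ y).re]).mp (by simpa using hc)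
      refine ⟨l₁, l₂, h₁, h₂, ?_, ?_⟩
      · rw [← hτ₁.ofReal_re_dotProduct_mulVec]
        exact congrArg _ (by simpa using congrFun hp 0)
      · rw [← hτ₂.ofReal_re_dotProduct_mulVec]
        exact congrArg _ (by simpa using congrFun hp 1)
    have hherm (a b : ℝ) : (a • τ₁ + b • τ₂).IsHermitian := by
      simp [IsHermitian, conjTranspose_add, conjTranspose_smul, hτ₁.eq, hτ₂.eq]
    have hpsd (a b : ℝ) (hab : ∀ l₁ l₂ : ℝ, 0 ≤ l₁ → 0 ≤ l₂ →
        0 ≤ a * (l₁ * v₁ 0 + l₂ * v₂ 0) + b * (l₁ * v₁ 1 + l₂ * v₂ 1)) :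
        (a • τ₁ + b • τ₂).PosSemidef := by
      refine .of_dotProduct_mulVec_nonneg (hherm a b) fun y => ?_
      obtain ⟨l₁, l₂, h₁, h₂, e₁, e₂⟩ := hform y
      rw [add_mulVec, smul_mulVec, smul_mulVec, dotProduct_add, dotProduct_smul,
        dotProduct_smul, e₁, e₂, Complex.real_smul, Complex.real_smul]
      exact_mod_cast hab l₁ l₂ h₁ h₂
    refine ⟨(v₂ 1 / D) • τ₁ + (-v₂ 0 / D) • τ₂, (-v₁ 1 / D) • τ₁ + (v₁ 0 / D) • τ₂,
      hpsd _ _ fun l₁ l₂ h₁ h₂ => ?_, hpsd _ _ fun l₁ l₂ h₁ h₂ => ?_, ?_, ?_⟩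
    · convert h₁ using 1
      field_simp
      rw [hDdef]
      ring
    · convert h₂ using 1
      field_simp
      rw [hDdef]
      ring
    · match_scalars <;> field_simp <;> rw [hDdef] <;> ring
    · match_scalars <;> field_simp <;> rw [hDdef] <;> ring
  · rintro ⟨η₁, η₂, h₁, h₂, rfl, rfl⟩
    have hv₁ := (hmem v₁).mpr ⟨1, 0, by simp⟩
    have hv₂ := (hmem v₂).mpr ⟨0, 1, by simp⟩
    have hsum : σ₁ ⊗ₖ (v₁ 0 • η₁ + v₂ 0 • η₂) + σ₂ ⊗ₖ (v₁ 1 • η₁ + v₂ 1 • η₂) =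
        (v₁ 0 • σ₁ + v₁ 1 • σ₂) ⊗ₖ η₁ + (v₂ 0 • σ₁ + v₂ 1 • σ₂) ⊗ₖ η₂ := by
      simp only [kronecker_add, add_kronecker, kronecker_smul, smul_kronecker]
      abel
    rw [hsum]
    exact (hv₁.kronecker h₁).add (hv₂.kronecker h₂)
end

section
/- Let σ_1, …, σ_d ∈ Her_m satisfy 0 ⪯ σ_i ⪯ I_m for all i. Then σ_1, …, σ_d are jointly measurable if and only if for every s ∈ ℕ and every tuple (τ_1, …, τ_d) of Hermitian s×s matrices with I_s − Σ_{i=1}^d ε_i τ_i positive semidefinite for all sign choices ε ∈ {−1, +1}^d, the matrix I_m ⊗ I_s − Σ_{i=1}^d (2σ_i − I_m) ⊗ τ_i is positive semidefinite. In other words, joint measurability is equivalent to the containment of the matrix diamond in the free spectrahedron defined by the matrices 2σ_i − I_m. -/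
open Matrix
open scoped Kronecker ComplexOrder

/-- `σ₁, …, σ_d` with `0 ⪯ σᵢ ⪯ I` are jointly measurable if the binary POVMs
`(σᵢ, I − σᵢ)` are marginals of a single POVM indexed by `{0,1}^d`. -/
def JointlyMeasurable {m d : ℕ} (σ : Fin d → Matrix (Fin m) (Fin m) ℂ) : Prop :=
  ∃ τ : (Fin d → Bool) → Matrix (Fin m) (Fin m) ℂ,
    (∀ ε, (τ ε).PosSemidef) ∧ (∑ ε : Fin d → Bool, τ ε = 1) ∧
    ∀ i : Fin d, ∑ ε ∈ Finset.univ.filter (fun ε : Fin d → Bool => ε i = true), τ ε = σ i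

section

variable {n : Type*}

/-- A complex functional on matrices is, on Hermitian matrices and up to real parts, the trace
pairing with a Hermitian matrix. -/
lemma exists_isHermitian_re_eq_re_trace_mul [Fintype n] [DecidableEq n] (φ : Matrix n n ℂ →ₗ[ℂ] ℂ) :
    ∃ X : Matrix n n ℂ, X.IsHermitian ∧
      ∀ A : Matrix n n ℂ, A.IsHermitian → (φ A).re = (X * A).trace.re := by
  let Y : Matrix n n ℂ := of fun j i => φ (single i j 1)
  have hY (A : Matrix n n ℂ) : φ A = (Y * A).trace := by
    conv_lhs => rw [matrix_eq_sum_single A]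
    have h (i j : n) : φ (single i j (A i j)) = Y j i * A i j := by
      rw [show single i j (A i j) = A i j • single i j (1 : ℂ) by simp, map_smul, smul_eq_mul,
        mul_comm]
      rfl
    simp only [map_sum, h, trace, diag, mul_apply]
    exact Finset.sum_comm
  refine ⟨(2⁻¹ : ℝ) • (Y + Yᴴ), ?_, fun A hA => ?_⟩
  · simp [IsHermitian, conjTranspose_smul, add_comm]
  · have h : (Yᴴ * A).trace.re = (Y * A).trace.re := by
      have : (Yᴴ * A).trace = star ((Y * A).trace) := by
        rw [← trace_conjTranspose, conjTranspose_mul, hA.eq, trace_mul_comm]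
      simp [this]
    rw [smul_mul, trace_smul, Complex.smul_re, add_mul, trace_add, Complex.add_re, h, hY,
      smul_eq_mul]
    ring

lemma Matrix.PosSemidef.norm_apply_le_re_trace [Fintype n] {A : Matrix n n ℂ} (hA : A.PosSemidef)
    (i j : n) : ‖A i j‖ ≤ A.trace.re := by
  classical
  open scoped MatrixOrder in
  obtain ⟨B, rfl⟩ := CStarAlgebra.nonneg_iff_eq_star_mul_self.mp hA.nonneg
  have hdiag (l : n) : ((star B * B) l l).re = ∑ k, ‖B k l‖ ^ 2 := by
    simp [mul_apply, star_apply, ← Complex.normSq_eq_norm_sq, Complex.normSq_apply]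
  have hle (l : n) : ((star B * B) l l).re ≤ (star B * B).trace.re := by
    simp only [trace, diag, Complex.re_sum]
    refine Finset.single_le_sum (f := fun l => ((star B * B) l l).re) (fun k _ => ?_)
      (Finset.mem_univ l)
    rw [hdiag]
    positivity
  calc ‖(star B * B) i j‖ ≤ ∑ k, ‖B k i‖ * ‖B k j‖ := by
        rw [mul_apply]
        refine (norm_sum_le _ _).trans (Finset.sum_le_sum fun k _ => ?_)
        simp [star_apply]
    _ ≤ ∑ k, (‖B k i‖ ^ 2 + ‖B k j‖ ^ 2) / 2 :=
        Finset.sum_le_sum fun k _ => by nlinarith [sq_nonneg (‖B k i‖ - ‖B k j‖)]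
    _ = (((star B * B) i i).re + ((star B * B) j j).re) / 2 := by
        rw [hdiag, hdiag, ← Finset.sum_add_distrib, Finset.sum_div]
    _ ≤ _ := by linarith [hle i, hle j]

lemma isClosed_setOf_posSemidef [Fintype n] : IsClosed {A : Matrix n n ℂ | A.PosSemidef} := by
  simp only [posSemidef_iff_dotProduct_mulVec, Set.ofPred_and, Set.ofPred_forall]
  refine .inter (isClosed_eq (by fun_prop) continuous_id) (isClosed_iInter fun x => ?_)
  exact isClosed_le continuous_const (by fun_prop)

lemma isCompact_setOf_posSemidef_re_trace_le [Fintype n] (c : ℝ) :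
    IsCompact {A : Matrix n n ℂ | A.PosSemidef ∧ A.trace.re ≤ c} := by
  have hK : IsCompact (Set.univ.pi fun _ : n => Set.univ.pi fun _ : n =>
      Metric.closedBall (0 : ℂ) c) :=
    isCompact_univ_pi fun _ => isCompact_univ_pi fun _ => isCompact_closedBall _ _
  refine IsCompact.of_isClosed_subset (X := Matrix n n ℂ) hK
    (isClosed_setOf_posSemidef.inter
      (isClosed_le (Complex.continuous_re.comp continuous_id.matrix_trace) continuous_const)) ?_
  rintro A ⟨hA, htr⟩ i - j -
  simpa using (hA.norm_apply_le_re_trace i j).trans htr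

end

/-- If the pair `(1, p)` is not of the form `(∑ G_ε, (∑ ε_i G_ε)_i)` with `G_ε ⪰ 0`, it is strictly
separated from this cone by Hermitian matrices. -/
lemma exists_posDef_trace_neg_of_forall_ne {m d : ℕ} (p : Fin d → Matrix (Fin m) (Fin m) ℂ)
    (hp : ∀ i, (p i).IsHermitian)
    (h : ∀ G : (Fin d → Bool) → Matrix (Fin m) (Fin m) ℂ, (∀ ε, (G ε).PosSemidef) →
      ∑ ε, G ε = 1 → ¬ ∀ i, ∑ ε : Fin d → Bool, (if ε i then (1 : ℝ) else -1) • G ε = p i) :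
    ∃ (X₀ : Matrix (Fin m) (Fin m) ℂ) (X : Fin d → Matrix (Fin m) (Fin m) ℂ),
      (∀ i, (X i).IsHermitian) ∧
      (∀ ε : Fin d → Bool, (X₀ + ∑ i, (if ε i then (1 : ℝ) else -1) • X i).PosDef) ∧
      X₀.trace.re + ∑ i, (X i * p i).trace.re < 0 := by
  have hm : m ≠ 0 := by
    rintro rfl
    exact h (fun _ => 0) (fun _ => .zero) (Subsingleton.elim _ _) fun _ => Subsingleton.elim _ _
  let L : ((Fin d → Bool) → Matrix (Fin m) (Fin m) ℂ) →
      Matrix (Fin m) (Fin m) ℂ × (Fin d → Matrix (Fin m) (Fin m) ℂ) := fun G =>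
    (∑ ε, G ε, fun i => ∑ ε : Fin d → Bool, (if ε i then (1 : ℝ) else -1) • G ε)
  have hL : IsLinearMap ℝ L := by
    refine ⟨fun G H => ?_, fun c G => ?_⟩
    · ext1
      · simp [L, Finset.sum_add_distrib]
      · ext1 i
        simp [L, Finset.sum_add_distrib]
    · ext1
      · simp [L, Finset.smul_sum]
      · ext1 i
        simp only [L, Pi.smul_apply, Prod.smul_snd, Finset.smul_sum]
        exact Finset.sum_congr rfl fun ε _ => smul_comm _ _ _
  have hLc : Continuous L := by fun_prop
  let S : Set ((Fin d → Bool) → Matrix (Fin m) (Fin m) ℂ) :=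
    {G | (∀ ε, (G ε).PosSemidef) ∧ ∑ ε, (G ε).trace.re = m}
  have hScompact : IsCompact S := by
    have hclosed : IsClosed S := by
      have h₁ : IsClosed (⋂ ε, {G : (Fin d → Bool) → Matrix (Fin m) (Fin m) ℂ |
          (G ε).PosSemidef}) :=
        isClosed_iInter fun ε => isClosed_setOf_posSemidef.preimage
          (continuous_apply (A := fun _ : Fin d → Bool => Matrix (Fin m) (Fin m) ℂ) ε)
      have h₂ : IsClosed {G : (Fin d → Bool) → Matrix (Fin m) (Fin m) ℂ |
          ∑ ε, (G ε).trace.re = m} := isClosed_eq (by fun_prop) continuous_const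
      convert h₁.inter h₂ using 1
      ext G
      simp [S]
    refine (isCompact_univ_pi fun _ =>
      isCompact_setOf_posSemidef_re_trace_le (m : ℝ)).of_isClosed_subset hclosed ?_
    rintro G ⟨hG, htr⟩ ε -
    refine ⟨hG ε, htr ▸ ?_⟩
    exact Finset.single_le_sum (f := fun ε => (G ε).trace.re)
      (fun ε _ => (Complex.le_def.1 (hG ε).trace_nonneg).1) (Finset.mem_univ ε)
  have hSconvex : Convex ℝ S := by
    rintro G ⟨hG, hGt⟩ H ⟨hH, hHt⟩ a b ha hb hab
    refine ⟨fun ε => ((hG ε).smul ha).add ((hH ε).smul hb), ?_⟩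
    simp only [Pi.add_apply, Pi.smul_apply, trace_add, trace_smul, Complex.add_re,
      Complex.smul_re, smul_eq_mul, Finset.sum_add_distrib, ← Finset.mul_sum, hGt, hHt]
    rw [← add_mul, hab, one_mul]
  have hmem : ((1 : Matrix (Fin m) (Fin m) ℂ), p) ∉ L '' S := by
    rintro ⟨G, ⟨hG, -⟩, hGp⟩
    exact h G hG (congrArg Prod.fst hGp) fun i => congrFun (congrArg Prod.snd hGp) i
  have : LocallyConvexSpace ℝ (Matrix (Fin m) (Fin m) ℂ) :=
    inferInstanceAs (LocallyConvexSpace ℝ (Fin m → Fin m → ℂ))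
  obtain ⟨f, u, hfu, huf⟩ := RCLike.geometric_hahn_banach_point_closed (𝕜 := ℂ)
    (hSconvex.is_linear_image hL) (hScompact.image hLc).isClosed hmem
  obtain ⟨X₀, hX₀, hfX₀⟩ := exists_isHermitian_re_eq_re_trace_mul
    (f.toLinearMap ∘ₗ LinearMap.inl ℂ (Matrix (Fin m) (Fin m) ℂ) (Fin d → Matrix (Fin m) (Fin m) ℂ))
  choose X hX hfX using fun i => exists_isHermitian_re_eq_re_trace_mul
    (f.toLinearMap ∘ₗ LinearMap.inr ℂ (Matrix (Fin m) (Fin m) ℂ) (Fin d → Matrix (Fin m) (Fin m) ℂ) ∘ₗ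
      LinearMap.single ℂ (fun _ => Matrix (Fin m) (Fin m) ℂ) i)
  have hf (A : Matrix (Fin m) (Fin m) ℂ) (B : Fin d → Matrix (Fin m) (Fin m) ℂ)
      (hA : A.IsHermitian) (hB : ∀ i, (B i).IsHermitian) :
      (f (A, B)).re = (X₀ * A).trace.re + ∑ i, (X i * B i).trace.re := by
    rw [← hfX₀ A hA, ← Finset.sum_congr rfl fun i _ => hfX i (B i) (hB i)]
    have hAB : (A, B) = (A, 0) +
        ∑ i, ((0 : Matrix (Fin m) (Fin m) ℂ), (Pi.single i (B i) : Fin d → Matrix (Fin m) (Fin m) ℂ)) := by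
      ext1
      · simp [Prod.fst_sum]
      · simp [Prod.snd_sum, Finset.univ_sum_single]
    rw [hAB, map_add, map_sum, Complex.add_re, Complex.re_sum]
    rfl
  have hm' : (m : ℝ) ≠ 0 := Nat.cast_ne_zero.2 hm
  refine ⟨X₀ - (u / m) • (1 : Matrix (Fin m) (Fin m) ℂ), X, hX, fun ε => ?_, ?_⟩
  · have hherm : (X₀ - (u / m) • (1 : Matrix (Fin m) (Fin m) ℂ) +
        ∑ i, (if ε i then (1 : ℝ) else -1) • X i).IsHermitian := by
      simp only [IsHermitian, conjTranspose_add, conjTranspose_sub, conjTranspose_sum,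
        conjTranspose_smul, hX₀.eq, (hX _).eq, conjTranspose_one, star_trivial]
    refine .of_dotProduct_mulVec_pos hherm fun x hx => ?_
    have hxpos : 0 < (star x ⬝ᵥ x).re :=
      (Complex.lt_def.1 (dotProduct_star_self_pos_iff.2 hx)).1
    let W := vecMulVec x (star x)
    have hW : W.PosSemidef := posSemidef_vecMulVec_self_star x
    have hWtr : W.trace = star x ⬝ᵥ x := by rw [trace_vecMulVec, dotProduct_comm]
    have hq (Z : Matrix (Fin m) (Fin m) ℂ) : star x ⬝ᵥ Z *ᵥ x = (Z * W).trace := by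
      rw [mul_vecMulVec, trace_vecMulVec, dotProduct_comm]
    let t : ℝ := m / (star x ⬝ᵥ x).re
    have ht : 0 < t := div_pos (by positivity) hxpos
    have htm : t * (star x ⬝ᵥ x).re = m := div_mul_cancel₀ _ hxpos.ne'
    have hmemS : Pi.single ε (t • W) ∈ S := by
      refine ⟨fun ε' => ?_, ?_⟩
      · obtain rfl | hne := eq_or_ne ε' ε
        · simpa using hW.smul ht.le
        · simpa [hne] using PosSemidef.zero
      · rw [Finset.sum_eq_single ε (fun ε' _ hne => by simp [hne]) (by simp)]
        rw [Pi.single_eq_same, trace_smul, Complex.smul_re, hWtr, smul_eq_mul, htm]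
    have hLW : L (Pi.single ε (t • W)) =
        (t • W, fun i => (if ε i then (1 : ℝ) else -1) • t • W) := by
      ext1
      · change ∑ ε', (Pi.single ε (t • W) : (Fin d → Bool) → _) ε' = _
        rw [Finset.sum_eq_single ε (fun ε' _ hne => by simp [hne]) (by simp), Pi.single_eq_same]
      · ext1 i
        simp only [L]
        rw [Finset.sum_eq_single ε (fun ε' _ hne => by simp [hne]) (by simp), Pi.single_eq_same]
    have hlt := huf _ ⟨_, hmemS, hLW⟩
    rw [show RCLike.re (f _) = (f _).re from rfl, hf _ _ (hW.smul ht.le).1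
      fun i => (((hW.smul ht.le).1).smul (.all _))] at hlt
    refine Complex.lt_def.2 ⟨?_, (hherm.im_star_dotProduct_mulVec_self x).symm⟩
    rw [hq]
    refine pos_of_mul_pos_right ?_ ht.le
    simp only [Matrix.mul_smul, trace_smul, Complex.smul_re, smul_eq_mul] at hlt
    simp only [add_mul, sub_mul, Finset.sum_mul, Matrix.smul_mul, one_mul, trace_add, trace_sub,
      trace_sum, trace_smul, Complex.add_re, Complex.sub_re, Complex.re_sum, Complex.smul_re,
      smul_eq_mul, hWtr, mul_add, mul_sub, Finset.mul_sum]
    rw [mul_left_comm t (u / m), htm, div_mul_cancel₀ _ hm',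
      Finset.sum_congr rfl fun i _ => mul_left_comm t _ _]
    linarith
  · have hlt := hf 1 p isHermitian_one hp
    rw [mul_one] at hlt
    rw [trace_sub, trace_smul, trace_one, Complex.sub_re, Complex.smul_re, Fintype.card_fin,
      Complex.natCast_re, smul_eq_mul, div_mul_cancel₀ _ hm']
    change (f _).re < u at hfu
    linarith

/-- Pairing the free spectrahedron inequality at the compressed tuple `X₀^{-1/2} X_i X₀^{-1/2}`
with a maximally entangled vector. -/
lemma re_trace_add_sum_re_trace_nonneg {m d : ℕ} (p : Fin d → Matrix (Fin m) (Fin m) ℂ)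
    (h : ∀ τ : Fin d → Matrix (Fin m) (Fin m) ℂ, (∀ i, (τ i).IsHermitian) →
      (∀ ε : Fin d → Bool, ((1 : Matrix (Fin m) (Fin m) ℂ) -
        ∑ i, (if ε i then (1 : ℝ) else -1) • τ i).PosSemidef) →
      ((1 : Matrix (Fin m × Fin m) (Fin m × Fin m) ℂ) - ∑ i, p i ⊗ₖ τ i).PosSemidef)
    (X₀ : Matrix (Fin m) (Fin m) ℂ) (X : Fin d → Matrix (Fin m) (Fin m) ℂ)
    (hX : ∀ i, (X i).IsHermitian)
    (hpos : ∀ ε : Fin d → Bool,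
      (X₀ + ∑ i, (if ε i then (1 : ℝ) else -1) • X i).PosDef) :
    0 ≤ X₀.trace.re + ∑ i, (X i * p i).trace.re := by
  have hX₀ : X₀.PosDef := by
    have h2 := (hpos fun _ => true).add (hpos fun _ => false)
    have : X₀ = (2⁻¹ : ℝ) • ((X₀ + ∑ i, (1 : ℝ) • X i) + (X₀ + ∑ i, (-1 : ℝ) • X i)) := by
      simp only [one_smul, neg_smul, Finset.sum_neg_distrib]
      module
    rw [this]
    exact PosDef.smul (by simpa using h2) (by norm_num)
  open scoped MatrixOrder in
  obtain ⟨C, hC⟩ := CStarAlgebra.nonneg_iff_eq_star_mul_self.mp hX₀.posSemidef.nonneg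
  rw [star_eq_conjTranspose] at hC
  have hDC : C⁻¹ * C = 1 := by
    refine nonsing_inv_mul C ?_
    have := (isUnit_iff_isUnit_det _).1 hX₀.isUnit
    rw [hC, det_mul] at this
    exact isUnit_of_mul_isUnit_right this
  have hCD : C * C⁻¹ = 1 := mul_eq_one_comm.1 hDC
  have hCDH : (C⁻¹)ᴴ * Cᴴ = 1 := by rw [← conjTranspose_mul, hCD, conjTranspose_one]
  have hDCH : Cᴴ * (C⁻¹)ᴴ = 1 := mul_eq_one_comm.1 hCDH
  let τ : Fin d → Matrix (Fin m) (Fin m) ℂ := fun i => -((C⁻¹)ᴴ * X i * C⁻¹)ᵀ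
  have hps := h τ (fun i => (isHermitian_conjTranspose_mul_mul _ (hX i)).transpose.neg) fun ε => by
    have heq : (1 : Matrix (Fin m) (Fin m) ℂ) - ∑ i, (if ε i then (1 : ℝ) else -1) • τ i =
        ((C⁻¹)ᴴ * (X₀ + ∑ i, (if ε i then (1 : ℝ) else -1) • X i) * C⁻¹)ᵀ := by
      have h1 : (C⁻¹)ᴴ * X₀ * C⁻¹ = 1 := by
        rw [hC, ← mul_assoc, hCDH, one_mul, hCD]
      rw [mul_add, add_mul, h1, transpose_add, transpose_one, Finset.mul_sum, Finset.sum_mul,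
        transpose_sum]
      simp only [τ, smul_neg, Finset.sum_neg_distrib, sub_neg_eq_add, Matrix.mul_smul,
        Matrix.smul_mul, transpose_smul]
    rw [heq]
    exact ((hpos ε).posSemidef.conjTranspose_mul_mul_same _).transpose
  let V : Matrix (Fin m) (Fin m) ℂ := (Cᴴ)ᵀ
  have hVH : Vᴴ = Cᵀ := by ext; simp [V]
  have hquad (A T : Matrix (Fin m) (Fin m) ℂ) :
      star (vec V) ⬝ᵥ (A ⊗ₖ T) *ᵥ vec V = (Cᵀ * T * (Cᴴ)ᵀ * Aᵀ).trace := by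
    rw [kronecker_mulVec_vec, star_vec_dotProduct_vec, hVH]
    simp only [V, mul_assoc]
  have hτ (i : Fin d) : Cᵀ * τ i * (Cᴴ)ᵀ = -(X i)ᵀ := by
    have : Cᵀ * τ i * (Cᴴ)ᵀ = -(Cᴴ * ((C⁻¹)ᴴ * X i * C⁻¹) * C)ᵀ := by
      simp [τ, mul_assoc]
    rw [this]
    congr 2
    calc _ = (Cᴴ * (C⁻¹)ᴴ) * X i * (C⁻¹ * C) := by simp only [mul_assoc]
      _ = X i := by rw [hDCH, hDC, one_mul, mul_one]
  have hnn := (Complex.le_def.1 (hps.dotProduct_mulVec_nonneg (vec V))).1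
  have hone : (1 : Matrix (Fin m × Fin m) (Fin m × Fin m) ℂ) =
      (1 : Matrix (Fin m) (Fin m) ℂ) ⊗ₖ (1 : Matrix (Fin m) (Fin m) ℂ) := one_kronecker_one.symm
  rw [hone, sub_mulVec, sum_mulVec, dotProduct_sub, dotProduct_sum] at hnn
  simp only [hquad, hτ, neg_mul, trace_neg, Finset.sum_neg_distrib, sub_neg_eq_add,
    transpose_one, mul_one, ← transpose_mul, trace_transpose, ← hC, Complex.add_re,
    Complex.re_sum, Complex.zero_re] at hnn
  rwa [Finset.sum_congr rfl fun i _ => congrArg Complex.re (trace_mul_comm (X i) (p i))]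

lemma sum_sign_smul_eq {m d : ℕ} (G : (Fin d → Bool) → Matrix (Fin m) (Fin m) ℂ) (i : Fin d) :
    ∑ ε : Fin d → Bool, (if ε i then (1 : ℝ) else -1) • G ε =
      (2 : ℂ) • ∑ ε ∈ Finset.univ.filter (fun ε : Fin d → Bool => ε i = true), G ε - ∑ ε, G ε := by
  rw [Finset.sum_filter, Finset.smul_sum, ← Finset.sum_sub_distrib]
  refine Finset.sum_congr rfl fun ε _ => ?_
  split_ifs
  · rw [one_smul, two_smul, add_sub_cancel_right]
  · simp

/-- Joint measurability of `σ₁, …, σ_d` is equivalent to the containment of the matrix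
diamond in the free spectrahedron defined by the matrices `2σᵢ − I`. -/
theorem jointly_measurable_iff_matrix_diamond_containment (m d : ℕ)
    (σ : Fin d → Matrix (Fin m) (Fin m) ℂ)
    (hσ : ∀ i, (σ i).PosSemidef ∧ (1 - σ i).PosSemidef) :
    JointlyMeasurable σ ↔
      ∀ (s : ℕ) (τ : Fin d → Matrix (Fin s) (Fin s) ℂ),
        (∀ i, (τ i).IsHermitian) →
        (∀ ε : Fin d → Bool,
          ((1 : Matrix (Fin s) (Fin s) ℂ) -
            ∑ i, (if ε i then (1 : ℝ) else -1) • τ i).PosSemidef) →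
        ((1 : Matrix (Fin m × Fin s) (Fin m × Fin s) ℂ) -
          ∑ i, ((2 : ℂ) • σ i - 1) ⊗ₖ τ i).PosSemidef := by
  constructor
  · rintro ⟨G, hG, hG1, hGσ⟩ s τ - hτ
    have hsum : (1 : Matrix (Fin m × Fin s) (Fin m × Fin s) ℂ) -
        ∑ i, ((2 : ℂ) • σ i - 1) ⊗ₖ τ i =
        ∑ ε, G ε ⊗ₖ (1 - ∑ i, (if ε i then (1 : ℝ) else -1) • τ i) := by
      have hp (i : Fin d) : (2 : ℂ) • σ i - 1 =
          ∑ ε : Fin d → Bool, (if ε i then (1 : ℝ) else -1) • G ε := by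
        rw [sum_sign_smul_eq, hGσ, hG1]
      have hone : (1 : Matrix (Fin m × Fin s) (Fin m × Fin s) ℂ) =
          (∑ ε, G ε) ⊗ₖ (1 : Matrix (Fin s) (Fin s) ℂ) := by rw [hG1, one_kronecker_one]
      rw [hone]
      simp only [hp]
      ext ⟨a, b⟩ ⟨a', b'⟩
      simp only [Matrix.sub_apply, Matrix.sum_apply, kronecker_apply, Matrix.smul_apply, mul_sub,
        Finset.sum_sub_distrib, Finset.sum_mul, Finset.mul_sum]
      rw [Finset.sum_comm]
      simp only [smul_mul_assoc, mul_smul_comm]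
    rw [hsum]
    exact posSemidef_sum _ fun ε _ => (hG ε).kronecker (hτ ε)
  · intro h
    by_contra hJM
    obtain ⟨X₀, X, hX, hpos, hneg⟩ := exists_posDef_trace_neg_of_forall_ne
      (fun i => (2 : ℂ) • σ i - 1)
      (fun i => ((hσ i).1.1.smul (by simp [IsSelfAdjoint])).sub isHermitian_one)
      fun G hG hG1 hGp => hJM ⟨G, hG, hG1, fun i => by
        have := hGp i
        rw [sum_sign_smul_eq, hG1] at this
        exact smul_right_injective _ two_ne_zero (sub_left_injective this)⟩
    exact hneg.not_ge (re_trace_add_sum_re_trace_nonneg _ (h m) X₀ X hX hpos)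
end

section
/- (Naimark's Dilation Theorem) Let τ_1, …, τ_d be m×m complex matrices forming a POVM, i.e. each τ_i is positive semidefinite and Σ_{i=1}^d τ_i = I_m. Then there exist n ∈ ℕ, a PVM σ_1, …, σ_d of n×n matrices (i.e. each σ_i is an orthogonal projection, σ_i* = σ_i = σ_i², and Σ_{i=1}^d σ_i = I_n), and a matrix v ∈ Mat_{n,m}(ℂ) with v*v = I_m, such that v* σ_i v = τ_i for all i = 1, …, d. -/
open Matrix
open scoped ComplexOrder

/-- The projection of `ℂ^(ι × κ)` onto the coordinates whose first index is `i`. -/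
def blockProjection {ι : Type*} (κ : Type*) [DecidableEq ι] [DecidableEq κ] (i : ι) :
    Matrix (ι × κ) (ι × κ) ℂ :=
  diagonal fun p => if p.1 = i then 1 else 0

section blockProjection

variable {ι κ μ : Type*} [DecidableEq ι] [DecidableEq κ]

theorem blockProjection_isHermitian (i : ι) : (blockProjection κ i).IsHermitian := by
  refine isHermitian_diagonal_of_self_adjoint _ ?_
  ext p
  simp [apply_ite]

theorem blockProjection_mul_self [Fintype ι] [Fintype κ] (i : ι) :
    blockProjection κ i * blockProjection κ i = blockProjection κ i := by
  simp [blockProjection, diagonal_mul_diagonal]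

theorem sum_blockProjection [Fintype ι] : ∑ i : ι, blockProjection κ i = 1 := by
  ext p q
  by_cases h : p = q <;> simp [blockProjection, Matrix.sum_apply, one_apply, h]

/-- Compressing a block projection by a stacked matrix gives the Gram matrix of that block. -/
theorem conjTranspose_mul_blockProjection_mul [Fintype ι] [Fintype κ]
    (B : ι → Matrix κ μ ℂ) (i : ι) :
    (of fun (p : ι × κ) j => B p.1 p.2 j)ᴴ * blockProjection κ i *
      (of fun (p : ι × κ) j => B p.1 p.2 j) = (B i)ᴴ * B i := by
  ext a b
  rw [mul_apply, mul_apply]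
  simp only [blockProjection, mul_diagonal, conjTranspose_apply, of_apply,
    Fintype.sum_prod_type, mul_ite, mul_one, mul_zero, ite_mul, zero_mul]
  rw [Finset.sum_comm]
  simp

end blockProjection

open scoped MatrixOrder in
theorem Matrix.PosSemidef.exists_eq_conjTranspose_mul_self {κ : Type*} [Fintype κ]
    {A : Matrix κ κ ℂ} (hA : A.PosSemidef) : ∃ B : Matrix κ κ ℂ, A = Bᴴ * B := by
  classical
  exact CStarAlgebra.nonneg_iff_eq_star_mul_self.mp hA.nonneg

/-- **Naimark's Dilation Theorem.** Every POVM `τ₁, …, τ_d` of `m × m` matrices dilates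
to a PVM `σ₁, …, σ_d` of `n × n` matrices via an isometry `v`: `v*σᵢv = τᵢ` for all `i`. -/
theorem naimark_dilation (m d : ℕ) (τ : Fin d → Matrix (Fin m) (Fin m) ℂ)
    (hpsd : ∀ i, (τ i).PosSemidef) (hsum : ∑ i, τ i = 1) :
    ∃ (n : ℕ) (σ : Fin d → Matrix (Fin n) (Fin n) ℂ) (v : Matrix (Fin n) (Fin m) ℂ),
      (∀ i, (σ i).IsHermitian) ∧ (∀ i, σ i * σ i = σ i) ∧ (∑ i, σ i = 1) ∧
      vᴴ * v = 1 ∧ ∀ i, vᴴ * σ i * v = τ i := by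
  choose B hB using fun i => (hpsd i).exists_eq_conjTranspose_mul_self
  let e := (finProdFinEquiv (m := d) (n := m)).symm
  let σ : Fin d → Matrix (Fin (d * m)) (Fin (d * m)) ℂ :=
    fun i => (blockProjection (Fin m) i).submatrix e e
  let v : Matrix (Fin (d * m)) (Fin m) ℂ :=
    (of fun (p : Fin d × Fin m) j => B p.1 p.2 j).submatrix e id
  have hσ : ∑ i, σ i = 1 := by
    have h := congrArg (fun M => M.submatrix e e) (sum_blockProjection (ι := Fin d) (κ := Fin m))
    ext p q
    simpa [σ, Matrix.sum_apply, one_apply] using congrFun (congrFun h p) q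
  have hv (i : Fin d) : vᴴ * σ i * v = τ i := by
    simp only [v, σ, conjTranspose_submatrix, submatrix_mul_equiv,
      conjTranspose_mul_blockProjection_mul, submatrix_id_id, ← hB]
  refine ⟨d * m, σ, v, fun i => (blockProjection_isHermitian i).submatrix e, fun i => ?_, hσ,
    ?_, hv⟩
  · simp only [σ, submatrix_mul_equiv, blockProjection_mul_self]
  · rw [← hsum, ← Finset.sum_congr rfl fun i _ => hv i, ← Matrix.sum_mul, ← Matrix.mul_sum, hσ,
      Matrix.mul_one]
end

section
/- For every d ≥ 3 there exists a quantum magic square at level 2, i.e. a d×d array (σ_{ij})_{i,j=1}^d of positive semidefinite 2×2 complex matrices with Σ_{j=1}^d σ_{ij} = I_2 for every row i and Σ_{i=1}^d σ_{ij} = I_2 for every column j, which does not dilate to a quantum permutation matrix: there exist no n ∈ ℕ, no d×d array (π_{ij})_{i,j=1}^d of n×n orthogonal projections (π_{ij}* = π_{ij} = π_{ij}²) with Σ_j π_{ij} = I_n for every row and Σ_i π_{ij} = I_n for every column, and no v ∈ Mat_{n,2}(ℂ) with v*v = I_2, such that v* π_{ij} v = σ_{ij} for all i, j. Consequently, the free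 convex hull of the quantum permutation matrices is strictly contained in the free spectrahedron of quantum magic squares. -/
open Matrix
open scoped ComplexOrder

section OrthogonalProjections

variable {ι n : Type*} [Fintype ι] [Fintype n] [DecidableEq n]

/-- Orthogonal projections that sum to the identity are pairwise orthogonal. -/
theorem mul_eq_zero_of_sum_projections_eq_one {P : ι → Matrix n n ℂ}
    (hherm : ∀ i, (P i).IsHermitian) (hidem : ∀ i, P i * P i = P i) (hsum : ∑ i, P i = 1)
    {i j : ι} (hij : i ≠ j) : P i * P j = 0 := by
  classical
  have key : ∀ k, (P k * P j)ᴴ * (P k * P j) = P j * P k * P j := fun k => by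
    rw [conjTranspose_mul, (hherm k).eq, (hherm j).eq, Matrix.mul_assoc,
      ← Matrix.mul_assoc (P k), hidem, Matrix.mul_assoc]
  have total : ∑ k, P j * P k * P j = P j := by
    rw [← Finset.sum_mul, ← Finset.mul_sum, hsum, Matrix.mul_one, hidem]
  have rest : ∑ k ∈ Finset.univ.erase j, (P k * P j)ᴴ * (P k * P j) = 0 := by
    rw [← Finset.add_sum_erase _ _ (Finset.mem_univ j), hidem, hidem] at total
    rw [Finset.sum_congr rfl fun k _ => key k]
    exact add_eq_left.mp total
  have htrace : ∑ k ∈ Finset.univ.erase j, ((P k * P j)ᴴ * (P k * P j)).trace = 0 := by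
    rw [← trace_sum, rest, trace_zero]
  rw [Finset.sum_eq_zero_iff_of_nonneg
    fun k _ => (posSemidef_conjTranspose_mul_self (P k * P j)).trace_nonneg] at htrace
  exact trace_conjTranspose_mul_self_eq_zero_iff.mp
    (htrace i (Finset.mem_erase.mpr ⟨hij, Finset.mem_univ i⟩))

end OrthogonalProjections

section OrthogonalSquare

variable {m k : Type*} [Fintype m]

/-- In a `3 × 3` square of matrices whose rows and columns are orthogonal decompositions of
one fixed matrix, the mixed Gram block of two diagonal entries is Hermitian. -/
theorem isHermitian_gram_of_orthogonal_square {w : Fin 3 → Fin 3 → Matrix m k ℂ}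
    {v : Matrix m k ℂ} (hrow : ∀ i j l, j ≠ l → (w i j)ᴴ * w i l = 0)
    (hcol : ∀ i l j, i ≠ l → (w i j)ᴴ * w l j = 0)
    (hrsum : ∀ i, ∑ j, w i j = v) (hcsum : ∀ j, ∑ i, w i j = v) :
    ((w 0 0)ᴴ * w 1 1).IsHermitian := by
  have expand : ∀ (u : Matrix m k ℂ) (a b c : Matrix m k ℂ), a + b + c = v →
      uᴴ * a + uᴴ * b + uᴴ * c = uᴴ * v := fun u a b c h => by
    rw [← h, Matrix.mul_add, Matrix.mul_add]
  have r : ∀ i, w i 0 + w i 1 + w i 2 = v := fun i => by rw [← hrsum i, Fin.sum_univ_three]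
  have c : ∀ j, w 0 j + w 1 j + w 2 j = v := fun j => by rw [← hcsum j, Fin.sum_univ_three]
  have h0 : (w 0 0)ᴴ * w 1 1 = (w 0 0)ᴴ * w 2 2 := by
    have e1 := expand (w 0 0) _ _ _ (c 1)
    have e2 := expand (w 0 0) _ _ _ (r 2)
    rw [hrow 0 0 1 (by decide), zero_add] at e1
    rw [hcol 0 2 0 (by decide), zero_add, ← e1, add_comm] at e2
    exact (add_right_cancel e2).symm
  have h1 : (w 1 1)ᴴ * w 0 0 = (w 1 1)ᴴ * w 2 2 := by
    have e1 := expand (w 1 1) _ _ _ (c 0)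
    have e2 := expand (w 1 1) _ _ _ (r 2)
    rw [hrow 1 1 0 (by decide), add_zero] at e1
    rw [hcol 1 2 1 (by decide), add_zero, ← e1, add_comm] at e2
    exact (add_right_cancel e2).symm
  have h2 : (w 2 2)ᴴ * w 0 0 = (w 2 2)ᴴ * w 1 1 := by
    have e1 := expand (w 2 2) _ _ _ (c 0)
    have e2 := expand (w 2 2) _ _ _ (r 1)
    rw [hrow 2 2 0 (by decide), add_zero] at e1
    rw [hcol 2 1 2 (by decide), add_zero, ← e1, add_comm] at e2
    exact (add_right_cancel e2).symm
  have h2' := congrArg conjTranspose h2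
  simp only [conjTranspose_mul, conjTranspose_conjTranspose] at h2'
  rw [IsHermitian, conjTranspose_mul, conjTranspose_conjTranspose, h1, ← h2', ← h0]

/-- A vector annihilated by a Gram matrix is annihilated by its factor. -/
theorem mulVec_eq_zero_of_gram_mulVec_eq_zero [Fintype k] {w : Matrix m k ℂ} {u : k → ℂ}
    (h : (wᴴ * w) *ᵥ u = 0) : w *ᵥ u = 0 :=
  (conjTranspose_mul_self_mulVec_eq_zero w u).mp h

end OrthogonalSquare

/-- A `2 × 2` Hermitian matrix that kills `(1, -1)` and a coordinate vector vanishes. -/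
theorem eq_zero_of_isHermitian_of_mulVec_eq_zero {X : Matrix (Fin 2) (Fin 2) ℂ}
    (hX : X *ᵥ ![1, -1] = 0) {i : Fin 2} (hi : X *ᵥ Pi.single i 1 = 0) : X = 0 := by
  have h0 := congrFun hX 0
  have h1 := congrFun hX 1
  have e0 := congrFun hi 0
  have e1 := congrFun hi 1
  simp [Matrix.mulVec, dotProduct, Fin.sum_univ_two] at h0 h1 e0 e1
  ext a b
  fin_cases i <;> fin_cases a <;> fin_cases b <;> simp_all

/-- A `3 × 3` quantum magic square of `2 × 2` matrices that is not even compatible with the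
second moments of a quantum permutation matrix. -/
noncomputable def rigidSquare : Fin 3 → Fin 3 → Matrix (Fin 2) (Fin 2) ℂ :=
  ![![!![1/4, 1/4; 1/4, 1/4], !![3/8, -1/8; -1/8, 3/8], !![3/8, -1/8; -1/8, 3/8]],
    ![!![1/2, 0; 0, 1/2], !![1/2, 0; 0, 0], !![0, 0; 0, 1/2]],
    ![!![1/4, -1/4; -1/4, 1/4], !![1/8, 1/8; 1/8, 5/8], !![5/8, 1/8; 1/8, 1/8]]]

theorem posSemidef_fin_two_of_real {a b c : ℝ} (ha : 0 ≤ a) (hb : 0 ≤ b) (hc : 0 ≤ c)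
    {s : ℝ} (hs : s ^ 2 = 1) :
    (!![(a + c : ℂ), s * c; s * c, b + c] : Matrix (Fin 2) (Fin 2) ℂ).PosSemidef := by
  have hd : (diagonal ![(a : ℂ), b]).PosSemidef := PosSemidef.diagonal fun i => by
    fin_cases i <;> simpa
  have hv := (posSemidef_vecMulVec_self_star (![1, (s : ℂ)])).smul
    (show (0 : ℂ) ≤ c by exact_mod_cast hc)
  have hs' : (s : ℂ) * s = 1 := by rw [← pow_two]; exact_mod_cast hs
  convert hd.add hv using 1
  ext i j
  fin_cases i <;> fin_cases j <;> simp [vecMulVec, hs', mul_comm]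

theorem rigidSquare_posSemidef (i j : Fin 3) : (rigidSquare i j).PosSemidef := by
  have h := fun (a b c s : ℝ) ha hb hc hs =>
    posSemidef_fin_two_of_real (a := a) (b := b) (c := c) (s := s) ha hb hc hs
  have h1 := h 0 0 (1/4) 1 (by norm_num) (by norm_num) (by norm_num) (by norm_num)
  have h2 := h (1/4) (1/4) (1/8) (-1) (by norm_num) (by norm_num) (by norm_num) (by norm_num)
  have h3 := h (1/2) (1/2) 0 1 (by norm_num) (by norm_num) (by norm_num) (by norm_num)
  have h4 := h (1/2) 0 0 1 (by norm_num) (by norm_num) (by norm_num) (by norm_num)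
  have h5 := h 0 (1/2) 0 1 (by norm_num) (by norm_num) (by norm_num) (by norm_num)
  have h6 := h 0 0 (1/4) (-1) (by norm_num) (by norm_num) (by norm_num) (by norm_num)
  have h7 := h 0 (1/2) (1/8) 1 (by norm_num) (by norm_num) (by norm_num) (by norm_num)
  have h8 := h (1/2) 0 (1/8) 1 (by norm_num) (by norm_num) (by norm_num) (by norm_num)
  norm_num at h1 h2 h3 h4 h5 h6 h7 h8
  fin_cases i <;> fin_cases j <;> norm_num [rigidSquare] <;> assumption

theorem rigidSquare_row_sum (i : Fin 3) : ∑ j, rigidSquare i j = 1 := by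
  ext a b
  fin_cases i <;> fin_cases a <;> fin_cases b <;>
    simp [rigidSquare, Fin.sum_univ_three] <;> norm_num

theorem rigidSquare_col_sum (j : Fin 3) : ∑ i, rigidSquare i j = 1 := by
  ext a b
  fin_cases j <;> fin_cases a <;> fin_cases b <;>
    simp [rigidSquare, Fin.sum_univ_three] <;> norm_num

/-- The entries of `rigidSquare` are not the Gram matrices of the entries of a square whose
rows and columns are orthogonal decompositions of one fixed matrix. -/
theorem not_gram_eq_rigidSquare {m : Type*} [Fintype m]
    {w : Fin 3 → Fin 3 → Matrix m (Fin 2) ℂ} {v : Matrix m (Fin 2) ℂ}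
    (hrow : ∀ i j l, j ≠ l → (w i j)ᴴ * w i l = 0)
    (hcol : ∀ i l j, i ≠ l → (w i j)ᴴ * w l j = 0)
    (hrsum : ∀ i, ∑ j, w i j = v) (hcsum : ∀ j, ∑ i, w i j = v) :
    ¬ ∀ i j, (w i j)ᴴ * w i j = rigidSquare i j := by
  intro hgram
  have hX := isHermitian_gram_of_orthogonal_square hrow hcol hrsum hcsum
  have hY := isHermitian_gram_of_orthogonal_square
    (w := fun i j => w i (Equiv.swap 1 2 j)) (v := v)
    (fun i j l h => hrow _ _ _ ((Equiv.swap 1 2).injective.ne h))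
    (fun i l j h => hcol _ _ _ h)
    (fun i => by rw [← hrsum i]; exact Equiv.sum_comp (Equiv.swap 1 2) (w i))
    (fun j => hcsum _)
  simp only [Equiv.swap_apply_left,
    Equiv.swap_apply_of_ne_of_ne (show (0 : Fin 3) ≠ 1 by decide)
      (show (0 : Fin 3) ≠ 2 by decide)] at hY
  have k00 : w 0 0 *ᵥ ![1, -1] = 0 := mulVec_eq_zero_of_gram_mulVec_eq_zero <| by
    rw [hgram]; ext a; fin_cases a <;> simp [rigidSquare]
  have k11 : w 1 1 *ᵥ Pi.single 1 1 = 0 := mulVec_eq_zero_of_gram_mulVec_eq_zero <| by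
    rw [hgram]; ext a; fin_cases a <;> simp [rigidSquare]
  have k12 : w 1 2 *ᵥ Pi.single 0 1 = 0 := mulVec_eq_zero_of_gram_mulVec_eq_zero <| by
    rw [hgram]; ext a; fin_cases a <;> simp [rigidSquare]
  have vanish : ∀ {y : Matrix m (Fin 2) ℂ} {i : Fin 2}, ((w 0 0)ᴴ * y).IsHermitian →
      y *ᵥ Pi.single i 1 = 0 → (w 0 0)ᴴ * y = 0 := fun {y i} hy hk => by
    refine eq_zero_of_isHermitian_of_mulVec_eq_zero (i := i) ?_ ?_
    · rw [← hy.eq, conjTranspose_mul, conjTranspose_conjTranspose, ← mulVec_mulVec, k00,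
        mulVec_zero]
    · rw [← mulVec_mulVec, hk, mulVec_zero]
  have e1 : (w 0 0)ᴴ * v = 0 := by
    rw [← hrsum 1, Fin.sum_univ_three, Matrix.mul_add, Matrix.mul_add,
      hcol 0 1 0 (by decide), vanish hX k11, vanish hY k12, add_zero, add_zero]
  have e2 : (w 0 0)ᴴ * v = rigidSquare 0 0 := by
    rw [← hrsum 0, Fin.sum_univ_three, Matrix.mul_add, Matrix.mul_add,
      hrow 0 0 1 (by decide), hrow 0 0 2 (by decide), hgram, add_zero, add_zero]
  have e3 := congrFun (congrFun (e2.symm.trans e1) 0) 0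
  simp [rigidSquare] at e3

/-- The direct sum of `rigidSquare` with the identity permutation of `k` further points. -/
noncomputable def paddedSquare (k : ℕ) (i j : Fin (3 + k)) : Matrix (Fin 2) (Fin 2) ℂ :=
  Fin.addCases (fun a => Fin.addCases (fun b => rigidSquare a b) (fun _ => 0) j)
    (fun a => Fin.addCases (fun _ => 0) (fun b => if a = b then 1 else 0) j) i

/-- For every `d ≥ 3` there is a `d × d` quantum magic square with POVM elements of size
`2 × 2` which does not dilate to a quantum permutation matrix. Consequently the free
convex hull of the quantum permutation matrices is strictly contained in the free
spectrahedron of quantum magic squares. -/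
theorem quantum_magic_square_without_dilation (d : ℕ) (hd : 3 ≤ d) :
    ∃ σ : Fin d → Fin d → Matrix (Fin 2) (Fin 2) ℂ,
      (∀ i j, (σ i j).PosSemidef) ∧
      (∀ i, ∑ j, σ i j = 1) ∧ (∀ j, ∑ i, σ i j = 1) ∧
      ¬ ∃ (n : ℕ) (π : Fin d → Fin d → Matrix (Fin n) (Fin n) ℂ)
          (v : Matrix (Fin n) (Fin 2) ℂ),
          (∀ i j, (π i j).IsHermitian) ∧ (∀ i j, π i j * π i j = π i j) ∧
          (∀ i, ∑ j, π i j = 1) ∧ (∀ j, ∑ i, π i j = 1) ∧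
          vᴴ * v = 1 ∧ ∀ i j, vᴴ * π i j * v = σ i j := by
  obtain ⟨k, rfl⟩ := Nat.exists_eq_add_of_le hd
  refine ⟨paddedSquare k, ?_, ?_, ?_, ?_⟩
  · intro i j
    induction i using Fin.addCases <;> induction j using Fin.addCases <;>
      simp only [paddedSquare, Fin.addCases_left, Fin.addCases_right]
    · exact rigidSquare_posSemidef _ _
    · exact PosSemidef.zero
    · exact PosSemidef.zero
    · split_ifs
      · exact PosSemidef.one
      · exact PosSemidef.zero
  · intro i
    induction i using Fin.addCases <;>
      simp [paddedSquare, Fin.sum_univ_add, rigidSquare_row_sum]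
  · intro j
    induction j using Fin.addCases <;>
      simp [paddedSquare, Fin.sum_univ_add, rigidSquare_col_sum]
  · rintro ⟨n, π, v, hherm, hidem, hr, hc, -, hdil⟩
    have gram : ∀ i j i' j', (π i j * v)ᴴ * (π i' j' * v) = vᴴ * (π i j * π i' j') * v :=
      fun i j i' j' => by
        rw [conjTranspose_mul, (hherm i j).eq]; simp only [Matrix.mul_assoc]
    have gram_self : ∀ i j, (π i j * v)ᴴ * (π i j * v) = paddedSquare k i j := fun i j => by
      rw [gram, hidem, hdil]
    have vanish : ∀ i j, paddedSquare k i j = 0 → π i j * v = 0 := fun i j h => by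
      rw [← conjTranspose_mul_self_eq_zero, gram_self, h]
    refine not_gram_eq_rigidSquare
      (w := fun a b => π (Fin.castAdd k a) (Fin.castAdd k b) * v) (v := v) ?_ ?_ ?_ ?_ ?_
    · intro i j l h
      rw [gram, mul_eq_zero_of_sum_projections_eq_one (hherm _) (hidem _) (hr _)
        ((Fin.castAdd_injective 3 k).ne h), Matrix.mul_zero, Matrix.zero_mul]
    · intro i l j h
      rw [gram, mul_eq_zero_of_sum_projections_eq_one (P := fun a => π a (Fin.castAdd k j))
        (fun _ => hherm _ _) (fun _ => hidem _ _) (hc _)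
        ((Fin.castAdd_injective 3 k).ne h), Matrix.mul_zero, Matrix.zero_mul]
    · intro i
      have h := congrArg (· * v) (hr (Fin.castAdd k i))
      simp only [Fin.sum_univ_add, Matrix.add_mul, Matrix.sum_mul, Matrix.one_mul] at h
      rwa [Finset.sum_eq_zero (s := (Finset.univ : Finset (Fin k))) fun b _ =>
        vanish _ _ (by simp [paddedSquare]), add_zero] at h
    · intro j
      have h := congrArg (· * v) (hc (Fin.castAdd k j))
      simp only [Fin.sum_univ_add, Matrix.add_mul, Matrix.sum_mul, Matrix.one_mul] at h
      rwa [Finset.sum_eq_zero (s := (Finset.univ : Finset (Fin k))) fun b _ =>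
        vanish _ _ (by simp [paddedSquare]), add_zero] at h
    · intro i j
      rw [gram_self]
      simp [paddedSquare]
end

section
/- (Bell's Theorem / CHSH) For two questions and two answers per party, the set of classical correlation matrices is strictly contained in the set of quantum correlation matrices: there exist d, s ∈ ℕ, a quantum state ρ ∈ Her_{ds} (positive semidefinite, trace 1), and POVMs (σ^{(a)}_x)_{x=1,2} on Her_d for a = 1,2 and (τ^{(b)}_y)_{y=1,2} on Her_s for b = 1,2, such that the table p(x,y|a,b) = tr(ρ (σ^{(a)}_x ⊗ τ^{(b)}_y)) ∈ ℝ^{16} does not lie in the convex hull of the set of product tables {(r_A(x|a)·r_B(y|b))_{a,b,x,y} : r_A(·|a), r_B(·|b) probability distributions on {1,2} for each a, b}. -/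
open Matrix
open scoped Kronecker ComplexOrder

/-- The set of classical correlation tables for two questions and two answers per party:
the convex hull of the product tables `r_A(x|a)·r_B(y|b)`. Coordinates are indexed by
`(a, b, x, y)`. -/
def ClassicalCorrelations : Set (Fin 2 → Fin 2 → Fin 2 → Fin 2 → ℝ) :=
  convexHull ℝ {t | ∃ rA rB : Fin 2 → Fin 2 → ℝ,
    (∀ a x, 0 ≤ rA a x) ∧ (∀ a, ∑ x, rA a x = 1) ∧
    (∀ b y, 0 ≤ rB b y) ∧ (∀ b, ∑ y, rB b y = 1) ∧
    ∀ a b x y, t a b x y = rA a x * rB b y}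

/-- The correlator `∑ (-1)^(x+y) t(x,y|a,b)` of a table for the pair of questions `(a, b)`. -/
def correlator (t : Fin 2 → Fin 2 → Fin 2 → Fin 2 → ℝ) (a b : Fin 2) : ℝ :=
  t a b 0 0 - t a b 0 1 - t a b 1 0 + t a b 1 1

/-- The Clauser–Horne–Shimony–Holt functional of a table. -/
def chsh (t : Fin 2 → Fin 2 → Fin 2 → Fin 2 → ℝ) : ℝ :=
  correlator t 0 0 + correlator t 0 1 + correlator t 1 0 - correlator t 1 1

lemma isLinearMap_chsh : IsLinearMap ℝ chsh where
  map_add s t := by simp only [chsh, correlator, Pi.add_apply]; ring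
  map_smul c t := by simp only [chsh, correlator, Pi.smul_apply, smul_eq_mul]; ring

lemma chsh_bound_of_abs_le_one {a₀ a₁ b₀ b₁ : ℝ} (ha₀ : |a₀| ≤ 1) (ha₁ : |a₁| ≤ 1)
    (hb₀ : |b₀| ≤ 1) (hb₁ : |b₁| ≤ 1) :
    a₀ * b₀ + a₀ * b₁ + a₁ * b₀ - a₁ * b₁ ≤ 2 := by
  have key {a : ℝ} (ha : |a| ≤ 1) (u : ℝ) : a * u ≤ |u| :=
    calc a * u ≤ |a * u| := le_abs_self _
      _ = |a| * |u| := abs_mul a u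
      _ ≤ |u| := mul_le_of_le_one_left (abs_nonneg u) ha
  have h : |b₀ + b₁| + |b₀ - b₁| ≤ 2 := by
    rw [abs_le] at hb₀ hb₁
    rcases abs_cases (b₀ + b₁) with h | h <;> rcases abs_cases (b₀ - b₁) with h' | h' <;> linarith
  linarith [key ha₀ (b₀ + b₁), key ha₁ (b₀ - b₁)]

lemma abs_sub_le_one_of_distribution {r : Fin 2 → ℝ} (hr : ∀ x, 0 ≤ r x) (hsum : ∑ x, r x = 1) :
    |r 0 - r 1| ≤ 1 := by
  rw [Fin.sum_univ_two] at hsum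
  rw [abs_le]
  constructor <;> linarith [hr 0, hr 1]

/-- The CHSH inequality. -/
lemma chsh_le_two_of_mem_classicalCorrelations {t : Fin 2 → Fin 2 → Fin 2 → Fin 2 → ℝ}
    (ht : t ∈ ClassicalCorrelations) : chsh t ≤ 2 := by
  refine convexHull_min ?_ (convex_halfSpace_le isLinearMap_chsh 2) ht
  rintro t ⟨rA, rB, hA, hA', hB, hB', h⟩
  have hA₂ (a) := abs_sub_le_one_of_distribution (hA a) (hA' a)
  have hB₂ (b) := abs_sub_le_one_of_distribution (hB b) (hB' b)
  have key := chsh_bound_of_abs_le_one (hA₂ 0) (hA₂ 1) (hB₂ 0) (hB₂ 1)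
  simp only [Set.mem_ofPred_eq, chsh, correlator, h]
  linarith

lemma posSemidef_of_isHermitian_of_isIdempotentElem {n : Type*} [Fintype n] {P : Matrix n n ℂ}
    (hP : P.IsHermitian) (hP' : IsIdempotentElem P) : P.PosSemidef := by
  have h := Matrix.posSemidef_conjTranspose_mul_self P
  rwa [hP.eq, hP'.eq] at h

/-- The qubit effect `(1 + c Z + s X) / 2`, where `Z` and `X` are Pauli matrices. -/
noncomputable def qubitEffect (c s : ℝ) : Matrix (Fin 2) (Fin 2) ℂ :=
  !![(1 + c) / 2, s / 2; s / 2, (1 - c) / 2]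

lemma posSemidef_qubitEffect {c s : ℝ} (h : c ^ 2 + s ^ 2 = 1) : (qubitEffect c s).PosSemidef := by
  have h' : (c : ℂ) ^ 2 + (s : ℂ) ^ 2 = 1 := mod_cast h
  apply posSemidef_of_isHermitian_of_isIdempotentElem
  · ext i j
    fin_cases i <;> fin_cases j <;> simp [qubitEffect]
  · ext i j
    fin_cases i <;> fin_cases j <;> simp [qubitEffect, Matrix.mul_apply] <;>
      first | ring1 | linear_combination (1 / 4 : ℂ) * h'

lemma qubitEffect_add_qubitEffect_neg (c s : ℝ) :
    qubitEffect c s + qubitEffect (-c) (-s) = 1 := by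
  ext i j
  fin_cases i <;> fin_cases j <;> simp [qubitEffect] <;> ring

/-- The maximally entangled state of two qubits. -/
noncomputable def bellState : Matrix (Fin 2 × Fin 2) (Fin 2 × Fin 2) ℂ :=
  Matrix.of fun p q => if p.1 = p.2 ∧ q.1 = q.2 then 1 / 2 else 0

lemma trace_bellState : bellState.trace = 1 := by
  simp [bellState, Matrix.trace, Fintype.sum_prod_type]

lemma posSemidef_bellState : bellState.PosSemidef := by
  apply posSemidef_of_isHermitian_of_isIdempotentElem
  · ext p q
    simp [bellState, and_comm, apply_ite]
  · ext ⟨i, j⟩ ⟨k, l⟩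
    fin_cases i <;> fin_cases j <;> fin_cases k <;> fin_cases l <;>
      simp [bellState, Matrix.mul_apply, Fintype.sum_prod_type]

lemma trace_bellState_mul_kronecker_qubitEffect (c s d t : ℝ) :
    ((bellState * (qubitEffect c s ⊗ₖ qubitEffect d t)).trace).re =
      (1 + c * d + s * t) / 4 := by
  have h : (bellState * (qubitEffect c s ⊗ₖ qubitEffect d t)).trace =
      (((1 + c * d + s * t) / 4 : ℝ) : ℂ) := by
    simp [bellState, qubitEffect, Matrix.trace, Matrix.mul_apply, Fintype.sum_prod_type]
    ring
  rw [h, Complex.ofReal_re]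

/-- The measurement of the qubit observable `c Z + s X`. -/
noncomputable def qubitMeasurement (c s : ℝ) : Fin 2 → Matrix (Fin 2) (Fin 2) ℂ :=
  ![qubitEffect c s, qubitEffect (-c) (-s)]

lemma posSemidef_qubitMeasurement {c s : ℝ} (h : c ^ 2 + s ^ 2 = 1) (x : Fin 2) :
    (qubitMeasurement c s x).PosSemidef := by
  fin_cases x
  · exact posSemidef_qubitEffect h
  · exact posSemidef_qubitEffect (by simpa using h)

lemma sum_qubitMeasurement (c s : ℝ) : ∑ x, qubitMeasurement c s x = 1 := by
  simpa [qubitMeasurement] using qubitEffect_add_qubitEffect_neg c s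

lemma correlator_qubitMeasurement (cA sA cB sB : Fin 2 → ℝ) (a b : Fin 2) :
    correlator (fun a b x y => ((bellState * (qubitMeasurement (cA a) (sA a) x ⊗ₖ
      qubitMeasurement (cB b) (sB b) y)).trace).re) a b = cA a * cB b + sA a * sB b := by
  simp only [correlator, qubitMeasurement, Matrix.cons_val_zero, Matrix.cons_val_one,
    trace_bellState_mul_kronecker_qubitEffect]
  ring

/-- **Bell's Theorem (CHSH).** For two questions and two answers per party there is a
quantum strategy — a state `ρ` and POVMs `(σ a x)ₓ` for Alice and `(τ b y)_y` for Bob —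
whose correlation table lies outside the convex hull of the classical (product)
correlation tables. -/
theorem bell_quantum_correlations_exceed_classical :
    ∃ (d s : ℕ) (ρ : Matrix (Fin d × Fin s) (Fin d × Fin s) ℂ)
      (σ : Fin 2 → Fin 2 → Matrix (Fin d) (Fin d) ℂ)
      (τ : Fin 2 → Fin 2 → Matrix (Fin s) (Fin s) ℂ),
      ρ.PosSemidef ∧ ρ.trace = 1 ∧
      (∀ a x, (σ a x).PosSemidef) ∧ (∀ a, ∑ x, σ a x = 1) ∧
      (∀ b y, (τ b y).PosSemidef) ∧ (∀ b, ∑ y, τ b y = 1) ∧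
      (fun a b x y => ((ρ * (σ a x ⊗ₖ τ b y)).trace).re) ∉ ClassicalCorrelations := by
  let cA : Fin 2 → ℝ := ![1, 0]
  let sA : Fin 2 → ℝ := ![0, 1]
  let cB : Fin 2 → ℝ := ![4 / 5, 4 / 5]
  let sB : Fin 2 → ℝ := ![3 / 5, -(3 / 5)]
  have hA (a) : cA a ^ 2 + sA a ^ 2 = 1 := by fin_cases a <;> norm_num [cA, sA]
  have hB (b) : cB b ^ 2 + sB b ^ 2 = 1 := by fin_cases b <;> norm_num [cB, sB]
  refine ⟨2, 2, bellState, fun a => qubitMeasurement (cA a) (sA a),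
    fun b => qubitMeasurement (cB b) (sB b), posSemidef_bellState, trace_bellState,
    fun a => posSemidef_qubitMeasurement (hA a), fun _ => sum_qubitMeasurement _ _,
    fun b => posSemidef_qubitMeasurement (hB b), fun _ => sum_qubitMeasurement _ _, fun h => ?_⟩
  have hle := chsh_le_two_of_mem_classicalCorrelations h
  simp only [chsh, correlator_qubitMeasurement] at hle
  norm_num [cA, sA, cB, sB] at hle
end

section
/- For 5 questions and 2 answers per party, the set of quantum correlation matrices is not closed: the set C_q ⊆ ℝ^{100} of all tables p(x,y|a,b) (with a, b ∈ {1,…,5}, x, y ∈ {1,2}) of the form p(x,y|a,b) = tr(ρ (σ^{(a)}_x ⊗ τ^{(b)}_y)), where d, s ∈ ℕ range over all finite dimensions, ρ ∈ Her_{ds} is positive semidefinite with trace 1, and (σ^{(a)}_x)_{x=1,2} and (τ^{(b)}_y)_{y=1,2} are POVMs on Her_d and Her_s respectively, is not a closed subset of ℝ^{100}. -/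
open Matrix
open scoped Kronecker ComplexOrder

/-- The set of quantum correlation tables for 5 questions and 2 answers per party:
all tables `p(x,y|a,b) = tr(ρ (σ a x ⊗ τ b y))` arising from a finite-dimensional
quantum state `ρ` and POVMs `(σ a x)ₓ` for Alice and `(τ b y)_y` for Bob. -/
def QuantumCorrelations : Set (Fin 5 → Fin 5 → Fin 2 → Fin 2 → ℝ) :=
  {t | ∃ (d s : ℕ) (ρ : Matrix (Fin d × Fin s) (Fin d × Fin s) ℂ)
      (σ : Fin 5 → Fin 2 → Matrix (Fin d) (Fin d) ℂ)
      (τ : Fin 5 → Fin 2 → Matrix (Fin s) (Fin s) ℂ),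
      ρ.PosSemidef ∧ ρ.trace = 1 ∧
      (∀ a x, (σ a x).PosSemidef) ∧ (∀ a, ∑ x, σ a x = 1) ∧
      (∀ b y, (τ b y).PosSemidef) ∧ (∀ b, ∑ y, τ b y = 1) ∧
      ∀ a b x y, t a b x y = ((ρ * (σ a x ⊗ₖ τ b y)).trace).re}

theorem LinearMap.exists_trace_eq_natCast_of_isIdempotentElem {K V : Type*} [Field K]
    [AddCommGroup V] [Module K V] [FiniteDimensional K V] {f : V →ₗ[K] V}
    (hf : IsIdempotentElem f) : ∃ r : ℕ, LinearMap.trace K V f = r :=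
  ⟨_, ((LinearMap.isProj_range_iff_isIdempotentElem f).2 hf).trace⟩

namespace Matrix

theorem sub_kronecker {R l m n p : Type*} [NonUnitalNonAssocRing R]
    (A₁ A₂ : Matrix l m R) (B : Matrix n p R) :
    (A₁ - A₂) ⊗ₖ B = A₁ ⊗ₖ B - A₂ ⊗ₖ B := by
  ext; simp [sub_mul]

theorem kronecker_sub {R l m n p : Type*} [NonUnitalNonAssocRing R]
    (A : Matrix l m R) (B₁ B₂ : Matrix n p R) :
    A ⊗ₖ (B₁ - B₂) = A ⊗ₖ B₁ - A ⊗ₖ B₂ := by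
  ext; simp [mul_sub]

theorem sum_kronecker {ι R l m n p : Type*} [NonUnitalNonAssocSemiring R] (s : Finset ι)
    (A : ι → Matrix l m R) (B : Matrix n p R) :
    (∑ i ∈ s, A i) ⊗ₖ B = ∑ i ∈ s, A i ⊗ₖ B := by
  ext; simp [Matrix.sum_apply, Finset.sum_mul]

theorem kronecker_sum {ι R l m n p : Type*} [NonUnitalNonAssocSemiring R] (s : Finset ι)
    (A : Matrix l m R) (B : ι → Matrix n p R) :
    A ⊗ₖ (∑ i ∈ s, B i) = ∑ i ∈ s, A ⊗ₖ B i := by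
  ext; simp [Matrix.sum_apply, Finset.mul_sum]

open scoped MatrixOrder in
theorem PosSemidef.exists_trace_mul_eq {n : Type*} [Fintype n] {A B : Matrix n n ℂ}
    (hA : A.PosSemidef) (hB : B.PosSemidef) :
    ∃ C : Matrix n n ℂ, (A * B).trace = (Cᴴ * C).trace ∧ (C = 0 → A * B = 0) := by
  classical
  obtain ⟨C, rfl⟩ := CStarAlgebra.nonneg_iff_eq_star_mul_self.1 hA.nonneg
  obtain ⟨D, rfl⟩ := CStarAlgebra.nonneg_iff_eq_star_mul_self.1 hB.nonneg
  simp only [star_eq_conjTranspose]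
  refine ⟨C * Dᴴ, ?_, fun h => ?_⟩
  · rw [← mul_assoc, trace_mul_comm, conjTranspose_mul, conjTranspose_conjTranspose]
    simp only [mul_assoc]
  · rw [mul_assoc, ← mul_assoc C, h, zero_mul, mul_zero]

theorem PosSemidef.trace_mul_nonneg {n : Type*} [Fintype n] {A B : Matrix n n ℂ}
    (hA : A.PosSemidef) (hB : B.PosSemidef) : 0 ≤ (A * B).trace := by
  obtain ⟨C, hC, -⟩ := hA.exists_trace_mul_eq hB
  exact hC ▸ (posSemidef_conjTranspose_mul_self C).trace_nonneg

theorem PosSemidef.mul_eq_zero_of_re_trace_mul_eq_zero {n : Type*} [Fintype n]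
    {A B : Matrix n n ℂ} (hA : A.PosSemidef) (hB : B.PosSemidef)
    (h : (A * B).trace.re = 0) : A * B = 0 := by
  obtain ⟨C, hC, hC0⟩ := hA.exists_trace_mul_eq hB
  refine hC0 (trace_conjTranspose_mul_self_eq_zero_iff.1 ?_)
  rw [← hC]
  exact Complex.ext h (Complex.nonneg_iff.1 (hA.trace_mul_nonneg hB)).2.symm

theorem kronecker_mul_apply {R l m n p q : Type*} [CommSemiring R] [Fintype m] [Fintype p]
    (A : Matrix l m R) (B : Matrix n p R) (C : Matrix (m × p) q R) (i : l) (j : n) (c : q) :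
    ((A ⊗ₖ B) * C) (i, j) c = (A * of (fun i' j' => C (i', j') c) * Bᵀ) i j := by
  simp only [mul_apply, Fintype.sum_prod_type, kronecker_apply, of_apply, transpose_apply,
    Finset.sum_mul]
  rw [Finset.sum_comm]
  exact Finset.sum_congr rfl fun _ _ => Finset.sum_congr rfl fun _ _ => by ring

/-- If the range of `X ≠ 0` is invariant under matrices `A i` that act on it as idempotents, and
their sum acts on it as a scalar, then this scalar is rational. -/
theorem exists_rat_eq_of_sum_mul_eq_smul {ι m n : Type*} [Fintype ι] [Fintype m] [Fintype n]
    {A : ι → Matrix m m ℂ} {B : ι → Matrix n n ℂ} {X : Matrix m n ℂ} (hX : X ≠ 0)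
    (hAB : ∀ i, A i * X = X * B i) (hA : ∀ i, A i * (A i * X) = A i * X) {α : ℂ}
    (hα : (∑ i, A i) * X = α • X) : ∃ q : ℚ, α = q := by
  classical
  let V := LinearMap.range X.mulVecLin
  have hmaps (i) : ∀ v ∈ V, (A i).mulVecLin v ∈ V := by
    rintro _ ⟨w, rfl⟩
    exact ⟨B i *ᵥ w, by simp [hAB]⟩
  let f (i) : V →ₗ[ℂ] V := (A i).mulVecLin.restrict (hmaps i)
  have hf (i) : IsIdempotentElem (f i) := by
    ext ⟨_, w, rfl⟩ : 2
    simpa [f] using congrArg (· *ᵥ w) (hA i)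
  have hsum : ∑ i, f i = α • LinearMap.id := by
    ext ⟨_, w, rfl⟩ : 2
    simpa [f, sum_mulVec, smul_mulVec, Matrix.sum_mul] using congrArg (· *ᵥ w) hα
  choose r hr using fun i => LinearMap.exists_trace_eq_natCast_of_isIdempotentElem (hf i)
  have htr := congrArg (LinearMap.trace ℂ V) hsum
  simp only [map_sum, hr, map_smul, LinearMap.trace_id, smul_eq_mul] at htr
  have hV : Module.finrank ℂ V ≠ 0 := fun h => hX <| by
    have := LinearMap.range_eq_bot.1 (Submodule.finrank_eq_zero.1 h)
    exact Matrix.toLin'.map_eq_zero_iff.1 this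
  refine ⟨(∑ i, r i : ℕ) / (Module.finrank ℂ V : ℕ), ?_⟩
  have : (Module.finrank ℂ V : ℂ) ≠ 0 := by exact_mod_cast hV
  push_cast
  rw [htr, mul_div_cancel_right₀ _ this]

theorem exists_rat_eq_of_synchronous {ι m n : Type*} [Fintype ι] [Fintype m] [Fintype n]
    [DecidableEq m] [DecidableEq n] {ρ : Matrix (m × n) (m × n) ℂ}
    {A : ι → Matrix m m ℂ} {B : ι → Matrix n n ℂ} (hρ : ρ.PosSemidef) (hρ0 : ρ ≠ 0)
    (hA : ∀ i, (A i).PosSemidef) (hA1 : ∀ i, (1 - A i).PosSemidef)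
    (hB : ∀ i, (B i).PosSemidef) (hB1 : ∀ i, (1 - B i).PosSemidef)
    (hAB : ∀ i, (ρ * (A i ⊗ₖ (1 - B i))).trace.re = 0)
    (hBA : ∀ i, (ρ * ((1 - A i) ⊗ₖ B i)).trace.re = 0) {α : ℝ}
    (hα : (ρ * ((∑ i, A i - (α : ℂ) • 1) ⊗ₖ (∑ i, B i - (α : ℂ) • 1))).trace.re = 0) :
    ∃ q : ℚ, α = q := by
  have h1 (i) : (A i ⊗ₖ (1 : Matrix n n ℂ)) * ρ = (A i ⊗ₖ B i) * ρ := by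
    have := ((hA i).kronecker (hB1 i)).mul_eq_zero_of_re_trace_mul_eq_zero hρ
      (by rw [trace_mul_comm, hAB])
    rwa [kronecker_sub, sub_mul, sub_eq_zero] at this
  have h2 (i) : ((1 : Matrix m m ℂ) ⊗ₖ B i) * ρ = (A i ⊗ₖ B i) * ρ := by
    have := ((hA1 i).kronecker (hB i)).mul_eq_zero_of_re_trace_mul_eq_zero hρ
      (by rw [trace_mul_comm, hBA])
    rwa [sub_kronecker, sub_mul, sub_eq_zero] at this
  set S := ∑ i, A i - (α : ℂ) • 1
  set T := ∑ i, B i - (α : ℂ) • 1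
  have hST : (S ⊗ₖ (1 : Matrix n n ℂ)) * ρ = ((1 : Matrix m m ℂ) ⊗ₖ T) * ρ := by
    simp only [S, T, sub_kronecker, kronecker_sub, sum_kronecker, kronecker_sum, sub_mul,
      Finset.sum_mul, h1, h2, smul_kronecker, kronecker_smul]
  have hS : Sᴴ = S := by
    simp [S, conjTranspose_sum, fun i => (hA i).1.eq]
  have hSρ : (S ⊗ₖ (1 : Matrix n n ℂ)) * ρ = 0 := by
    rw [← conjTranspose_mul_self_mul_eq_zero]
    refine (posSemidef_conjTranspose_mul_self _).mul_eq_zero_of_re_trace_mul_eq_zero hρ ?_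
    rw [mul_assoc, hST, conjTranspose_kronecker, hS, conjTranspose_one, ← mul_assoc,
      ← mul_kronecker_mul, mul_one, one_mul, trace_mul_comm, hα]
  obtain ⟨⟨i₀, j₀⟩, c, hc⟩ : ∃ x c, ρ x c ≠ 0 := by
    by_contra! h
    exact hρ0 (ext h)
  let X : Matrix m n ℂ := of fun i j => ρ (i, j) c
  have hX {A₁ A₂ : Matrix m m ℂ} {B₁ B₂ : Matrix n n ℂ}
      (h : (A₁ ⊗ₖ B₁) * ρ = (A₂ ⊗ₖ B₂) * ρ) : A₁ * X * B₁ᵀ = A₂ * X * B₂ᵀ := by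
    ext i j
    rw [← kronecker_mul_apply, ← kronecker_mul_apply, h]
  have hX1 (i) : A i * X = X * (B i)ᵀ := by
    simpa using hX ((h1 i).trans (h2 i).symm)
  have hX2 (i) : A i * (A i * X) = A i * X := by
    have := hX (h1 i)
    rw [transpose_one, Matrix.mul_one] at this
    rw [hX1, ← Matrix.mul_assoc, ← this, hX1]
  have hX3 : (∑ i, A i) * X = (α : ℂ) • X := by
    have := hX (A₂ := 0) (B₂ := 1) (hSρ.trans (by simp))
    simpa [S, Matrix.sub_mul, sub_eq_zero] using this
  obtain ⟨q, hq⟩ :=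
    exists_rat_eq_of_sum_mul_eq_smul (fun h => hc (congrFun₂ h i₀ j₀)) hX1 hX2 hX3
  exact ⟨q, by exact_mod_cast hq⟩

/-- A matrix supported on the diagonal and on the graph of `f`. If `f` is an involution and
`w ∘ f = 1 - w`, it is a projection whenever `s ^ 2 = 1`. -/
noncomputable def pairingMatrix {ι : Type*} [DecidableEq ι] (f : ι → ι) (w : ι → ℝ) (s : ℝ) :
    Matrix ι ι ℂ :=
  of fun i j => ((if i = j then w i else 0) + if f i = j then s * √(w i * w (f i)) else 0 : ℝ)

section pairingMatrix

variable {ι : Type*} [DecidableEq ι] {f : ι → ι} {w : ι → ℝ} {s : ℝ}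

theorem conjTranspose_pairingMatrix (hf : Function.Involutive f) :
    (pairingMatrix f w s)ᴴ = pairingMatrix f w s := by
  ext i j
  simp only [pairingMatrix, conjTranspose_apply, of_apply, RCLike.star_def, Complex.conj_ofReal]
  congr 2
  · split_ifs <;> grind
  · by_cases h : f i = j
    · subst h
      simp [hf i, mul_comm]
    · have : f j ≠ i := fun h' => h (by rw [← h', hf j])
      simp [h, this]

theorem isIdempotentElem_pairingMatrix [Fintype ι] (hf : Function.Involutive f)
    (hw : ∀ i, 0 ≤ w i) (hwf : ∀ i, w (f i) = 1 - w i) (hs : s ^ 2 = 1) :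
    IsIdempotentElem (pairingMatrix f w s) := by
  ext i j
  have hsq : √(w i * w (f i)) ^ 2 = w i * w (f i) :=
    Real.sq_sqrt (mul_nonneg (hw _) (hw _))
  simp only [pairingMatrix, mul_apply, of_apply, ← Complex.ofReal_mul, ← Complex.ofReal_sum]
  congr 1
  simp only [add_mul, Finset.sum_add_distrib, ite_mul, zero_mul, Finset.sum_ite_eq,
    Finset.mem_univ, if_true, hf i, mul_comm (w (f i)) (w i)]
  rw [hwf] at hsq ⊢
  generalize √(w i * (1 - w i)) = r at hsq
  have hr : s * r * (s * r) = w i * (1 - w i) := by linear_combination r ^ 2 * hs + hsq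
  split_ifs <;> first | ring1 | linear_combination hr

theorem pairingMatrix_add_pairingMatrix_neg :
    pairingMatrix f w s + pairingMatrix f w (-s) = diagonal fun i => ((2 * w i : ℝ) : ℂ) := by
  ext i j
  simp only [pairingMatrix, add_apply, of_apply, diagonal_apply]
  split_ifs <;> push_cast <;> ring

end pairingMatrix

/-- There are five projections whose sum is the scalar matrix `2 + p / (2 M)`. -/
theorem exists_five_projections_sum_eq_smul_one (M : ℕ) [NeZero M] (p : ZMod M) :
    ∃ P : Fin 5 → Matrix (ZMod M × Bool) (ZMod M × Bool) ℂ,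
      (∀ a, (P a)ᴴ = P a) ∧ (∀ a, IsIdempotentElem (P a)) ∧
      ∑ a, P a = ((2 + p.val / M / 2 : ℝ) : ℂ) • 1 := by
  have hM : (0 : ℝ) < M := by exact_mod_cast NeZero.pos M
  let z (k : ZMod M) : ℝ := k.val / M
  have hz0 (k) : 0 ≤ z k := by positivity
  have hz1 (k) : z k ≤ 1 := (div_le_one hM).2 (by exact_mod_cast (ZMod.val_lt k).le)
  have hz (k) : z p - z k + z (k - p) = 0 ∨ z p - z k + z (k - p) = 1 := by
    simp only [z, ← add_div, ← sub_div]
    rcases lt_or_ge (p.val + (k - p).val) M with h | h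
    · left
      have := ZMod.val_add_of_lt h
      rw [add_sub_cancel] at this
      rw [this]; push_cast; ring_nf
    · right
      have := ZMod.val_add_val_of_le h
      rw [add_sub_cancel] at this
      have h' : (p.val + (k - p).val : ℝ) = k.val + M := by exact_mod_cast this
      rw [div_eq_one_iff_eq hM.ne']; linarith
  let f₁ (x : ZMod M × Bool) : ZMod M × Bool := (x.1, !x.2)
  let f₂ (x : ZMod M × Bool) : ZMod M × Bool := (if x.2 then x.1 + p else x.1 - p, !x.2)
  let w₁ (x : ZMod M × Bool) : ℝ := if x.2 then 1 - z x.1 / 2 else z x.1 / 2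
  let w₂ (x : ZMod M × Bool) : ℝ :=
    if x.2 then (z x.1 + z p / 2) / 2 else 1 - (z (x.1 - p) + z p / 2) / 2
  let D (x : ZMod M × Bool) : ℝ := if x.2 then 0 else z p - z x.1 + z (x.1 - p)
  have hf₁ : Function.Involutive f₁ := by rintro ⟨k, _ | _⟩ <;> simp [f₁]
  have hf₂ : Function.Involutive f₂ := by rintro ⟨k, _ | _⟩ <;> simp [f₂]
  have hw₁ (x) : 0 ≤ w₁ x := by
    rcases x with ⟨k, _ | _⟩ <;> simp only [w₁] <;> grind
  have hw₂ (x) : 0 ≤ w₂ x := by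
    rcases x with ⟨k, _ | _⟩ <;> simp only [w₂] <;> grind
  have hwf₁ (x) : w₁ (f₁ x) = 1 - w₁ x := by
    rcases x with ⟨k, _ | _⟩ <;> simp [w₁, f₁]
  have hwf₂ (x) : w₂ (f₂ x) = 1 - w₂ x := by
    rcases x with ⟨k, _ | _⟩ <;> simp [w₂, f₂]
  refine ⟨![pairingMatrix f₁ w₁ 1, pairingMatrix f₁ w₁ (-1), pairingMatrix f₂ w₂ 1,
    pairingMatrix f₂ w₂ (-1), diagonal fun x => (D x : ℂ)], ?_, ?_, ?_⟩
  · simp [Fin.forall_fin_succ, conjTranspose_pairingMatrix hf₁, conjTranspose_pairingMatrix hf₂,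
      diagonal_conjTranspose, Pi.star_def]
  · have hD : IsIdempotentElem (diagonal fun x => (D x : ℂ)) := by
      rw [IsIdempotentElem, diagonal_mul_diagonal]
      congr 1
      ext ⟨k, _ | _⟩
      · rcases hz k with h | h <;> simp [D, h]
      · simp [D]
    simp [Fin.forall_fin_succ, isIdempotentElem_pairingMatrix hf₁ hw₁ hwf₁,
      isIdempotentElem_pairingMatrix hf₂ hw₂ hwf₂, hD]
  · simp only [Fin.sum_univ_five, cons_val]
    rw [pairingMatrix_add_pairingMatrix_neg, add_assoc (diagonal _) (pairingMatrix _ _ _),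
      pairingMatrix_add_pairingMatrix_neg, diagonal_add, diagonal_add, smul_one_eq_diagonal]
    congr 1
    ext ⟨k, _ | _⟩ <;> simp [w₁, w₂, D, z] <;> ring

end Matrix

namespace QuantumCorrelations

/-- In a realization by a state `ρ` and POVMs `σ`, `τ`, this is the expectation of
`(∑ a, σ a 0 - α) ⊗ (∑ b, τ b 0 - α)`. -/
noncomputable def covariance (α : ℝ) (t : Fin 5 → Fin 5 → Fin 2 → Fin 2 → ℝ) : ℝ :=
  ∑ a, ∑ b, t a b 0 0 - α * ∑ a, ∑ y, t a 0 0 y - α * ∑ b, ∑ x, t 0 b x 0 + α ^ 2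

/-- The deviation of a table from being synchronous with vanishing covariance. -/
noncomputable def defect (α : ℝ) (t : Fin 5 → Fin 5 → Fin 2 → Fin 2 → ℝ) : ℝ :=
  ∑ a, (t a a 0 1 + t a a 1 0) + |covariance α t|

theorem continuous_defect (α : ℝ) : Continuous (defect α) := by
  unfold defect covariance
  fun_prop

theorem covariance_eq {m n : Type*} [Fintype m] [Fintype n] [DecidableEq m] [DecidableEq n]
    {ρ : Matrix (m × n) (m × n) ℂ} {σ : Fin 5 → Fin 2 → Matrix m m ℂ}
    {τ : Fin 5 → Fin 2 → Matrix n n ℂ} {t : Fin 5 → Fin 5 → Fin 2 → Fin 2 → ℝ}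
    (hρ : ρ.trace = 1) (hσ : ∀ a, ∑ x, σ a x = 1) (hτ : ∀ b, ∑ y, τ b y = 1)
    (ht : ∀ a b x y, t a b x y = ((ρ * (σ a x ⊗ₖ τ b y)).trace).re) (α : ℝ) :
    covariance α t = (ρ * ((∑ a, σ a 0 - (α : ℂ) • 1) ⊗ₖ
      (∑ b, τ b 0 - (α : ℂ) • 1))).trace.re := by
  have h₁ (a) : ∑ y, t a 0 0 y = (ρ * (σ a 0 ⊗ₖ 1)).trace.re := by
    simp only [ht, ← hτ 0, kronecker_sum, Matrix.mul_sum, trace_sum, Complex.re_sum]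
  have h₂ (b) : ∑ x, t 0 b x 0 = (ρ * (1 ⊗ₖ τ b 0)).trace.re := by
    simp only [ht, ← hσ 0, sum_kronecker, Matrix.mul_sum, trace_sum, Complex.re_sum]
  simp only [covariance, h₁, h₂]
  simp only [ht, sub_kronecker, kronecker_sub, sum_kronecker, kronecker_sum,
    smul_kronecker, kronecker_smul, Matrix.mul_sub, Matrix.mul_sum, Matrix.mul_smul, trace_sub,
    trace_sum, trace_smul, Complex.sub_re, Complex.re_sum, smul_eq_mul, Complex.re_ofReal_mul,
    one_kronecker_one, Matrix.mul_one, hρ, Complex.one_re, Finset.sum_sub_distrib]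
  simp only [← Finset.mul_sum]
  rw [Finset.sum_comm]
  ring

theorem nonneg {t : Fin 5 → Fin 5 → Fin 2 → Fin 2 → ℝ} (ht : t ∈ QuantumCorrelations)
    (a b : Fin 5) (x y : Fin 2) : 0 ≤ t a b x y := by
  obtain ⟨d, s, ρ, σ, τ, hρ, -, hσ, -, hτ, -, ht⟩ := ht
  rw [ht]
  exact (Complex.nonneg_iff.1 (hρ.trace_mul_nonneg ((hσ a x).kronecker (hτ b y)))).1

theorem sum_eq_one {t : Fin 5 → Fin 5 → Fin 2 → Fin 2 → ℝ} (ht : t ∈ QuantumCorrelations)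
    (a b : Fin 5) : ∑ x, ∑ y, t a b x y = 1 := by
  obtain ⟨d, s, ρ, σ, τ, -, hρ, -, hσ, -, hτ, ht⟩ := ht
  simp only [ht, ← Complex.re_sum, ← trace_sum, ← Matrix.mul_sum, ← kronecker_sum,
    ← sum_kronecker, hσ, hτ, one_kronecker_one, Matrix.mul_one, hρ, Complex.one_re]

theorem le_one {t : Fin 5 → Fin 5 → Fin 2 → Fin 2 → ℝ} (ht : t ∈ QuantumCorrelations)
    (a b : Fin 5) (x y : Fin 2) : t a b x y ≤ 1 := by
  rw [← sum_eq_one ht a b]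
  refine (Finset.single_le_sum (f := fun y => t a b x y) (fun y _ => nonneg ht a b x y)
    (Finset.mem_univ y)).trans ?_
  exact Finset.single_le_sum (f := fun x => ∑ y, t a b x y)
    (fun x _ => Finset.sum_nonneg fun y _ => nonneg ht a b x y) (Finset.mem_univ x)

theorem isCompact_of_isClosed (h : IsClosed QuantumCorrelations) :
    IsCompact QuantumCorrelations :=
  (isCompact_Icc (a := 0) (b := 1)).of_isClosed_subset h fun _ ht =>
    ⟨fun a b x y => nonneg ht a b x y, fun a b x y => le_one ht a b x y⟩

theorem exists_rat_eq_of_defect_nonpos {α : ℝ} {t : Fin 5 → Fin 5 → Fin 2 → Fin 2 → ℝ}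
    (ht : t ∈ QuantumCorrelations) (h : defect α t ≤ 0) : ∃ q : ℚ, α = q := by
  have h0 (a) (_ : a ∈ Finset.univ) : 0 ≤ t a a 0 1 + t a a 1 0 :=
    add_nonneg (nonneg ht _ _ _ _) (nonneg ht _ _ _ _)
  have hsum : ∑ a, (t a a 0 1 + t a a 1 0) = 0 :=
    le_antisymm (by linarith [abs_nonneg (covariance α t), h, defect.eq_1 α t])
      (Finset.sum_nonneg h0)
  have hcov : covariance α t = 0 := abs_nonpos_iff.1 (by linarith [defect.eq_1 α t])
  have hsync (a) : t a a 0 1 = 0 ∧ t a a 1 0 = 0 := by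
    have := (Finset.sum_eq_zero_iff_of_nonneg h0).1 hsum a (Finset.mem_univ a)
    exact (add_eq_zero_iff_of_nonneg (nonneg ht _ _ _ _) (nonneg ht _ _ _ _)).1 this
  obtain ⟨d, s, ρ, σ, τ, hρ, hρ1, hσ, hσ1, hτ, hτ1, ht⟩ := ht
  have hσ' (a) : 1 - σ a 0 = σ a 1 := by rw [← hσ1 a, Fin.sum_univ_two, add_sub_cancel_left]
  have hτ' (b) : 1 - τ b 0 = τ b 1 := by rw [← hτ1 b, Fin.sum_univ_two, add_sub_cancel_left]
  refine exists_rat_eq_of_synchronous (ρ := ρ) (A := fun a => σ a 0) (B := fun b => τ b 0) hρ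
    (by rintro rfl; simp at hρ1) (fun a => hσ a 0) (fun a => hσ' a ▸ hσ a 1) (fun b => hτ b 0)
    (fun b => hτ' b ▸ hτ b 1) (fun a => ?_) (fun a => ?_) ?_
  · rw [hτ', ← ht, (hsync a).1]
  · rw [hσ', ← ht, (hsync a).2]
  · rw [← covariance_eq hρ1 hσ1 hτ1 ht, hcov]

/-- The maximally entangled state. -/
noncomputable def maxEntangled (n : Type*) [Fintype n] [DecidableEq n] :
    Matrix (n × n) (n × n) ℂ :=
  (Fintype.card n : ℂ)⁻¹ • vecMulVec (fun x => if x.1 = x.2 then 1 else 0)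
    (star fun x => if x.1 = x.2 then 1 else 0)

section maxEntangled

variable {n : Type*} [Fintype n] [DecidableEq n]

theorem posSemidef_maxEntangled : (maxEntangled n).PosSemidef :=
  (posSemidef_vecMulVec_self_star _).smul (by positivity)

theorem trace_maxEntangled_mul_kronecker_transpose (A B : Matrix n n ℂ) :
    (maxEntangled n * (A ⊗ₖ Bᵀ)).trace = (Fintype.card n : ℂ)⁻¹ * (A * B).trace := by
  rw [maxEntangled, smul_mul, trace_smul, smul_eq_mul, vecMulVec_mul, trace_vecMulVec]
  congr 1
  simp [dotProduct, vecMul, Fintype.sum_prod_type, trace, mul_apply]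
  exact Finset.sum_comm

theorem trace_maxEntangled [Nonempty n] : (maxEntangled n).trace = 1 := by
  simpa using trace_maxEntangled_mul_kronecker_transpose (1 : Matrix n n ℂ) 1

end maxEntangled

theorem exists_mem_defect_eq_of_fin {d : ℕ} [NeZero d] {P : Fin 5 → Matrix (Fin d) (Fin d) ℂ}
    (hP : ∀ a, (P a)ᴴ = P a) (hP2 : ∀ a, IsIdempotentElem (P a)) {β : ℝ}
    (hβ : ∑ a, P a = (β : ℂ) • 1) (α : ℝ) :
    ∃ t ∈ QuantumCorrelations, defect α t = (β - α) ^ 2 := by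
  have hpsd {Q : Matrix (Fin d) (Fin d) ℂ} (hQ : Qᴴ = Q) (hQ2 : IsIdempotentElem Q) :
      Q.PosSemidef := by
    have := posSemidef_conjTranspose_mul_self Q
    rwa [hQ, hQ2.eq] at this
  let σ (a : Fin 5) (x : Fin 2) : Matrix (Fin d) (Fin d) ℂ := if x = 0 then P a else 1 - P a
  have hσ (a x) : (σ a x).PosSemidef := by
    simp only [σ]
    split_ifs
    · exact hpsd (hP a) (hP2 a)
    · exact hpsd (by simp [hP]) (hP2 a).one_sub
  have hσ1 (a) : ∑ x, σ a x = 1 := by simp [σ]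
  have hτ1 (b) : ∑ y, (σ b y)ᵀ = 1 := by rw [← transpose_sum, hσ1, transpose_one]
  refine ⟨fun a b x y => (maxEntangled (Fin d) * (σ a x ⊗ₖ (σ b y)ᵀ)).trace.re,
    ⟨d, d, maxEntangled _, σ, fun b y => (σ b y)ᵀ, posSemidef_maxEntangled,
      trace_maxEntangled, hσ, hσ1, fun b y => (hσ b y).transpose, hτ1, fun _ _ _ _ => rfl⟩, ?_⟩
  have hcov : covariance α _ = _ := covariance_eq (τ := fun b y => (σ b y)ᵀ)
    (trace_maxEntangled (n := Fin d)) hσ1 hτ1 (fun _ _ _ _ => rfl) α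
  have hS : ∑ a, σ a 0 - (α : ℂ) • 1 = ((β - α : ℝ) : ℂ) • 1 := by
    simp [σ, hβ, sub_smul]
  have hT : ∑ a, (σ a 0)ᵀ - (α : ℂ) • 1 = ((β - α : ℝ) : ℂ) • 1 := by
    simpa [transpose_sum] using congrArg transpose hS
  rw [defect, hcov, hS, hT, smul_kronecker, kronecker_smul, one_kronecker_one, Matrix.mul_smul,
    Matrix.mul_smul, Matrix.mul_one, trace_smul, trace_smul, trace_maxEntangled, smul_eq_mul,
    smul_eq_mul, mul_one, ← Complex.ofReal_mul, Complex.ofReal_re, abs_mul_self, ← sq]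
  simp only [trace_maxEntangled_mul_kronecker_transpose]
  simp [σ, mul_sub, sub_mul, (hP2 _).eq]

theorem exists_mem_defect_eq {n : Type*} [Fintype n] [DecidableEq n] [Nonempty n]
    {P : Fin 5 → Matrix n n ℂ} (hP : ∀ a, (P a)ᴴ = P a) (hP2 : ∀ a, IsIdempotentElem (P a))
    {β : ℝ} (hβ : ∑ a, P a = (β : ℂ) • 1) (α : ℝ) :
    ∃ t ∈ QuantumCorrelations, defect α t = (β - α) ^ 2 := by
  let e := reindexAlgEquiv ℂ ℂ (Fintype.equivFin n)
  have : NeZero (Fintype.card n) := ⟨Fintype.card_ne_zero⟩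
  refine exists_mem_defect_eq_of_fin (P := fun a => e (P a)) (fun a => ?_)
    (fun a => (hP2 a).map e) ?_ α
  · simp [e, hP]
  · rw [← map_sum, hβ, map_smul, map_one]

end QuantumCorrelations

/-- For 5 questions and 2 answers per party, the set of quantum correlation matrices is
not closed. -/
theorem quantum_correlations_not_closed : ¬ IsClosed QuantumCorrelations := by
  intro hclosed
  have hne : QuantumCorrelations.Nonempty :=
    let ⟨_, hP, hP2, hsum⟩ := Matrix.exists_five_projections_sum_eq_smul_one 1 0
    let ⟨t, ht, _⟩ := QuantumCorrelations.exists_mem_defect_eq hP hP2 hsum 0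
    ⟨t, ht⟩
  let α : ℝ := 2 + (√2 / 2) / 2
  obtain ⟨t, ht, hmin⟩ := (QuantumCorrelations.isCompact_of_isClosed hclosed).exists_isMinOn hne
    (QuantumCorrelations.continuous_defect α).continuousOn
  have hle : QuantumCorrelations.defect α t ≤ 0 := by
    refine le_of_forall_pos_le_add fun ε hε => ?_
    have hsqrt : √2 / 2 < 1 := by
      nlinarith [Real.sq_sqrt (zero_le_two (α := ℝ)), Real.sqrt_nonneg 2]
    obtain ⟨q, hq, hq'⟩ := exists_rat_btwn (lt_min hsqrt (lt_add_of_pos_right (√2 / 2) hε))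
    obtain ⟨hq1, hq2⟩ := lt_min_iff.1 hq'
    have hq0 : (0 : ℝ) < q := lt_of_le_of_lt (by positivity) hq
    have hnum : (q.num.toNat : ℝ) = q.num := by
      exact_mod_cast Int.toNat_of_nonneg (Rat.num_nonneg.2 (by exact_mod_cast hq0.le))
    have hqdiv : (q.num.toNat : ℝ) / q.den = q := by
      rw [hnum]; exact_mod_cast q.num_div_den
    have hlt : q.num.toNat < q.den := by
      have : (q.num.toNat : ℝ) < q.den := by
        rwa [← hqdiv, div_lt_one (by exact_mod_cast q.den_pos)] at hq1
      exact_mod_cast this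
    have : NeZero q.den := ⟨q.den_nz⟩
    obtain ⟨P, hP, hP2, hsum⟩ := exists_five_projections_sum_eq_smul_one q.den q.num.toNat
    rw [ZMod.val_natCast_of_lt hlt, hqdiv] at hsum
    obtain ⟨u, hu, hdef⟩ := QuantumCorrelations.exists_mem_defect_eq hP hP2 hsum α
    refine (hmin hu).trans ?_
    simp only [hdef, α]
    nlinarith [Real.sqrt_nonneg 2]
  obtain ⟨q, hq⟩ := QuantumCorrelations.exists_rat_eq_of_defect_nonpos ht hle
  refine irrational_sqrt_two ⟨4 * (q - 2), ?_⟩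
  push_cast
  rw [← hq]
  ring
end
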